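/- arXiv:2408.15456 — 3 statements merged into one kernel-verified Lean document; each statement's English description precedes it below -/
import Mathlib

section
/- Let 𝕏 ⊆ ℝⁿ be open and let ℒ : 𝕏 → ℝ be real-analytic and nonnegative. Suppose the set Z := {x ∈ 𝕏 : ∇ℒ(x) = 0} decomposes as Z = M ∪ S, where M is the set of global minimizers of ℒ on 𝕏 and every point of S is a strict saddle of the gradient-flow dynamics ẋ = -∇ℒ(x), i.e., the Hessian of ℒ at each point of S has at least one strictly negative eigenvalue and at least one nonnegative eigenvalue. Assume further that every maximal solution of ẋ = -∇ℒ(x) is precompact, i.e., remains in a compact subset of 𝕏 for all forward time. Then the set of initial conditions ξ ∈ 𝕏 whose solution does not converge as t → ∞ to a point of M has Lebesgue measure zero. -/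
open MeasureTheory Set Filter

section

open scoped Topology

/-- Hadamard's division lemma for analytic functions: if `π` is a norm-nonincreasing projection
with `z = π z + ℓ z • e`, then `f - f ∘ π` is divisible by `ℓ` near the origin. -/
theorem AnalyticAt.exists_eq_add_mul {E : Type*} [NormedAddCommGroup E] [NormedSpace ℝ E]
    {f : E → ℝ} (hf : AnalyticAt ℝ f 0) (ℓ : E →L[ℝ] ℝ) (e : E) (π : E →L[ℝ] E)
    (hπ : ‖π‖ ≤ 1) (hdec : ∀ z, z = π z + ℓ z • e) :
    ∃ k : E → ℝ, AnalyticAt ℝ k 0 ∧ ∀ᶠ z in 𝓝 0, f z = f (π z) + ℓ z * k z := by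
  obtain ⟨p, r, hp⟩ := hf
  let q : FormalMultilinearSeries ℝ E ℝ := fun m =>
    ∑ j : Fin (m + 1), ((p (m + 1)).curryMid j e).compContinuousLinearMap
      (fun l => if l.val < j.val then π else ContinuousLinearMap.id ℝ E)
  have hqnorm : ∀ m, ‖q m‖ ≤ (m + 1) * (‖p (m + 1)‖ * ‖e‖) := by
    intro m
    have : ∀ j : Fin (m + 1), ‖((p (m + 1)).curryMid j e).compContinuousLinearMap
      (fun l => if l.val < j.val then π else ContinuousLinearMap.id ℝ E)‖
        ≤ ‖p (m + 1)‖ * ‖e‖ := by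
      intro j
      refine (ContinuousMultilinearMap.norm_compContinuousLinearMap_le _ _).trans ?_
      have h1 : ‖(p (m + 1)).curryMid j e‖ ≤ ‖p (m + 1)‖ * ‖e‖ := by
        simpa using ((p (m + 1)).curryMid j).le_opNorm e
      have h2 : (∏ l : Fin m, ‖(if l.val < j.val then π else ContinuousLinearMap.id ℝ E)‖) ≤ 1 := by
        apply Finset.prod_le_one
        · intros; positivity
        · intro l _
          split_ifs
          · exact hπ
          · exact ContinuousLinearMap.norm_id_le
      calc _ ≤ (‖p (m + 1)‖ * ‖e‖) * 1 := by gcongr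
        _ = _ := mul_one _
    refine (norm_sum_le _ _).trans ((Finset.sum_le_sum fun j _ => this j).trans ?_)
    simp
  have hprad : 0 < p.radius := hp.r_pos.trans_le hp.r_le
  obtain ⟨s, hs0, hs⟩ := ENNReal.lt_iff_exists_nnreal_btwn.1 hprad
  have hs0' : 0 < s := by exact_mod_cast hs0
  obtain ⟨C, hC, hpC⟩ := p.norm_mul_pow_le_of_lt_radius hs
  have hqrad : 0 < q.radius := by
    have hle : ((s / 2 : NNReal) : ENNReal) ≤ q.radius := by
      apply q.le_radius_of_bound (C * ‖e‖ / s)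
      intro m
      have h2 : ((m : ℝ) + 1) ≤ 2 ^ m := by
        have := Nat.lt_two_pow_self (n := m)
        exact_mod_cast this
      have hsr : (0 : ℝ) < s := by exact_mod_cast hs0'
      calc ‖q m‖ * ((s / 2 : NNReal) : ℝ) ^ m
          ≤ ((m + 1) * (‖p (m + 1)‖ * ‖e‖)) * (s / 2) ^ m := by
            push_cast; gcongr; exact hqnorm m
        _ ≤ (2 ^ m * (‖p (m + 1)‖ * ‖e‖)) * (s / 2) ^ m := by gcongr
        _ = ‖e‖ / s * (‖p (m + 1)‖ * s ^ (m + 1)) := by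
            rw [div_pow]; field_simp; ring
        _ ≤ ‖e‖ / s * C := by gcongr; exact hpC (m + 1)
        _ = _ := by ring
    refine lt_of_lt_of_le ?_ hle
    exact_mod_cast (half_pos hs0')
  have hq := q.hasFPowerSeriesOnBall hqrad
  refine ⟨q.sum, hq.analyticAt, ?_⟩
  have hπc : Tendsto π (𝓝 0) (𝓝 0) := by simpa using π.continuous.tendsto 0
  filter_upwards [Metric.eball_mem_nhds (0 : E) hp.r_pos,
    hπc (Metric.eball_mem_nhds (0 : E) hp.r_pos),
    Metric.eball_mem_nhds (0 : E) hqrad] with z hz hπz hzq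
  have S1 := hp.hasSum hz
  have S2 := hp.hasSum (show π z ∈ _ from hπz)
  have S3 := (hq.hasSum hzq).mul_left (ℓ z)
  rw [zero_add] at S1 S2 S3
  have key : ∀ m, p (m + 1) (fun _ => z) - p (m + 1) (fun _ => π z) = ℓ z * q m (fun _ => z) := by
    intro m
    let Tj : ℕ → ℝ := fun j => p (m + 1) (fun i => if i.val < j then π z else z)
    have hT : ∀ j : Fin (m + 1), Tj j - Tj (j + 1) =
        ℓ z * ((p (m + 1)).curryMid j e).compContinuousLinearMap
      (fun l => if l.val < j.val then π else ContinuousLinearMap.id ℝ E) (fun _ => z) := by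
      intro j
      let v : Fin (m + 1) → E := fun i => if i.val < j then π z else z
      have e1 : Tj j = p (m + 1) (Function.update v j z) := by
        simp only [Tj]; congr 1; ext i
        by_cases hij : i = j
        · subst hij; simp
        · simp [hij, v]
      have e2 : Tj (j + 1) = p (m + 1) (Function.update v j (π z)) := by
        simp only [Tj]; congr 1; ext i
        by_cases hij : i = j
        · subst hij; simp
        · have : i.val ≠ j.val := fun h => hij (Fin.ext h)
          have h3 : i.val < j.val + 1 ↔ i.val < j.val := by omega
          simp [hij, v, h3]
      have e3 : ((p (m + 1)).curryMid j e).compContinuousLinearMap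
          (fun l => if l.val < j.val then π else ContinuousLinearMap.id ℝ E) (fun _ => z)
          = p (m + 1) (Function.update v j e) := by
        rw [ContinuousMultilinearMap.compContinuousLinearMap_apply,
          ContinuousMultilinearMap.curryMid_apply]
        congr 1
        refine Fin.insertNth_eq_iff.2 ⟨by simp, ?_⟩
        ext l
        simp only [Fin.removeNth, Function.update_of_ne (Fin.succAbove_ne j l), v]
        by_cases hl : l.val < j.val
        · have : l.castSucc < j := hl
          simp [Fin.succAbove_of_castSucc_lt _ _ this, hl]
        · have : j ≤ l.castSucc := not_lt.1 hl
          have h4 : ¬ (l.val + 1 < j.val) := by omega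
          simp [Fin.succAbove_of_le_castSucc _ _ this, hl, h4]
      rw [e1, e2, e3, ← (p (m + 1)).map_update_sub, ← smul_eq_mul,
        ← (p (m + 1)).map_update_smul]
      congr 2
      nth_rw 1 [hdec z]
      simp
    have hsum := Finset.sum_range_sub' Tj (m + 1)
    rw [← Fin.sum_univ_eq_sum_range (fun j => Tj j - Tj (j + 1))] at hsum
    have h0 : Tj 0 = p (m + 1) (fun _ => z) := by simp [Tj]
    have h1 : Tj (m + 1) = p (m + 1) (fun _ => π z) := by
      simp only [Tj]; congr 1; ext i; rw [if_pos i.isLt]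
    rw [← h0, ← h1, ← hsum]
    simp only [q, sum_apply, Finset.mul_sum]
    exact Finset.sum_congr rfl fun j _ => hT j
  have S4 := S1.sub S2
  have S5 := (hasSum_nat_add_iff' 1).2 S4
  simp only [key, Finset.range_one, Finset.sum_singleton] at S5
  have h00 : p 0 (fun _ => z) = p 0 (fun _ => π z) := by congr 1; ext i; exact i.elim0
  rw [h00, sub_self, sub_zero] at S5
  have := S5.unique S3
  linarith

namespace AnalyticGerm

variable {E : Type*} [NormedAddCommGroup E] [NormedSpace ℝ E]

/-- Division of an analytic function on `E × ℝ` by the last variable. -/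
theorem exists_div_snd {f : E × ℝ → ℝ} (hf : AnalyticAt ℝ f 0) :
    ∃ k : E × ℝ → ℝ, AnalyticAt ℝ k 0 ∧ ∀ᶠ z in 𝓝 0, f z = f (z.1, 0) + z.2 * k z := by
  have hπ : ‖(ContinuousLinearMap.inl ℝ E ℝ).comp (ContinuousLinearMap.fst ℝ E ℝ)‖ ≤ 1 := by
    refine ContinuousLinearMap.opNorm_le_bound _ zero_le_one fun z => ?_
    simpa using norm_fst_le z
  simpa using hf.exists_eq_add_mul (ContinuousLinearMap.snd ℝ E ℝ) (0, 1) _ hπ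
    (fun z => by ext <;> simp)

/-- Taylor expansion with analytic coefficients in the last variable. -/
theorem exists_taylor_snd {f : E × ℝ → ℝ} (hf : AnalyticAt ℝ f 0) (d : ℕ) :
    ∃ (a : ℕ → E → ℝ) (u : E × ℝ → ℝ), (∀ i, AnalyticAt ℝ (a i) 0) ∧ AnalyticAt ℝ u 0 ∧
      ∀ᶠ z in 𝓝 0, f z = ∑ i ∈ Finset.range d, a i z.1 * z.2 ^ i + z.2 ^ d * u z := by
  induction d with
  | zero => exact ⟨fun _ _ => 0, f, fun _ => analyticAt_const, hf, by simp⟩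
  | succ d ih =>
    obtain ⟨a, u, ha, hu, hfu⟩ := ih
    obtain ⟨k, hk, huk⟩ := exists_div_snd hu
    have hu0 : AnalyticAt ℝ (fun x : E => u (x, 0)) 0 :=
      AnalyticAt.fun_comp (g := u) (f := fun x : E => (x, (0 : ℝ))) hu (by fun_prop)
    refine ⟨fun i => if i = d then fun x => u (x, 0) else a i, k, fun i => ?_, hk, ?_⟩
    · dsimp only; split_ifs
      · exact hu0
      · exact ha i
    · filter_upwards [hfu, huk] with z h1 h2
      rw [h1, h2, Finset.sum_range_succ]
      have : ∑ i ∈ Finset.range d, (if i = d then fun x => u (x, 0) else a i) z.1 * z.2 ^ i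
          = ∑ i ∈ Finset.range d, a i z.1 * z.2 ^ i :=
        Finset.sum_congr rfl fun i hi => by rw [if_neg (Finset.mem_range.1 hi).ne]
      rw [this, if_pos rfl]
      ring

/-- Division of an analytic function by a coordinate. -/
theorem exists_div_coord {n : ℕ} {f : (Fin n → ℝ) → ℝ} (hf : AnalyticAt ℝ f 0) (j : Fin n) :
    ∃ k : (Fin n → ℝ) → ℝ, AnalyticAt ℝ k 0 ∧
      ∀ᶠ z in 𝓝 0, f z = f (Function.update z j 0) + z j * k z := by
  let π : (Fin n → ℝ) →L[ℝ] (Fin n → ℝ) := ContinuousLinearMap.pi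
    (fun i => if i = j then 0 else ContinuousLinearMap.proj (R := ℝ) (φ := fun _ => ℝ) i)
  have hπe : ∀ z, π z = Function.update z j 0 := by
    intro z; ext i
    by_cases h : i = j
    · subst h; simp [π]
    · simp [π, h]
  have hπ : ‖π‖ ≤ 1 := by
    refine ContinuousLinearMap.opNorm_le_bound _ zero_le_one fun z => ?_
    rw [one_mul, pi_norm_le_iff_of_nonneg (norm_nonneg _)]
    intro i
    rw [hπe]
    by_cases h : i = j
    · subst h; simp
    · simpa [h] using norm_le_pi_norm z i
  obtain ⟨k, hk, h⟩ := hf.exists_eq_add_mul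
    (ContinuousLinearMap.proj (R := ℝ) (φ := fun _ : Fin n => ℝ) j) (Pi.single j 1) π hπ
    (fun z => by
      ext i
      rw [hπe]
      by_cases h : i = j
      · subst h; simp
      · simp [h])
  exact ⟨k, hk, by simpa [hπe] using h⟩

/-- Germs of analytic functions form an integral domain. -/
theorem eventually_zero_of_mul {f g : E → ℝ} (hf : AnalyticAt ℝ f 0) (hg : AnalyticAt ℝ g 0)
    (h : ∀ᶠ z in 𝓝 (0 : E), f z * g z = 0) :
    (∀ᶠ z in 𝓝 (0 : E), f z = 0) ∨ ∀ᶠ z in 𝓝 (0 : E), g z = 0 := by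
  obtain ⟨r, hr, hball⟩ := Metric.eventually_nhds_iff_ball.1
    (h.and (hf.eventually_analyticAt.and hg.eventually_analyticAt))
  by_cases hz : ∀ z ∈ Metric.ball (0 : E) r, f z = 0
  · exact Or.inl (eventually_of_mem (Metric.ball_mem_nhds _ hr) hz)
  · push Not at hz
    obtain ⟨z₀, hz₀, hfz⟩ := hz
    right
    have hgz : g =ᶠ[𝓝 z₀] 0 := by
      have h1 := (hball z₀ hz₀).2.1.continuousAt.eventually_ne hfz
      filter_upwards [h1, Metric.isOpen_ball.mem_nhds hz₀] with z h1 h2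
      exact (mul_eq_zero.1 (hball z h2).1).resolve_left h1
    have hga : AnalyticOnNhd ℝ g (Metric.ball 0 r) := fun z hz => (hball z hz).2.2
    have := hga.eqOn_zero_of_preconnected_of_eventuallyEq_zero
      (convex_ball (0 : E) r).isPreconnected hz₀ hgz
    exact eventually_of_mem (Metric.ball_mem_nhds _ hr) this

theorem eventually_eq_of_mul_left {f g h : E → ℝ} (hf : AnalyticAt ℝ f 0)
    (hg : AnalyticAt ℝ g 0) (hh : AnalyticAt ℝ h 0) (hf0 : ¬ ∀ᶠ z in 𝓝 (0 : E), f z = 0)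
    (he : ∀ᶠ z in 𝓝 (0 : E), f z * g z = f z * h z) : ∀ᶠ z in 𝓝 (0 : E), g z = h z := by
  have := (eventually_zero_of_mul hf (hg.sub hh)
    (he.mono fun z hz => by simp [mul_sub, hz])).resolve_left hf0
  exact this.mono fun z hz => sub_eq_zero.1 hz

end AnalyticGerm

namespace AnalyticGerm

/-- `f` agrees near the origin with a monomial times a nonvanishing analytic function. -/
def IsNormal {n : ℕ} (f : (Fin n → ℝ) → ℝ) : Prop :=
  ∃ (α : Fin n → ℕ) (u : (Fin n → ℝ) → ℝ), AnalyticAt ℝ u 0 ∧ u 0 ≠ 0 ∧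
    ∀ᶠ z in 𝓝 0, f z = (∏ i, z i ^ α i) * u z

theorem analyticAt_monomial {n : ℕ} (α : Fin n → ℕ) (z₀ : Fin n → ℝ) :
    AnalyticAt ℝ (fun z : Fin n → ℝ => ∏ i, z i ^ α i) z₀ :=
  Finset.analyticAt_fun_prod _ fun i _ =>
    ((ContinuousLinearMap.proj (R := ℝ) (φ := fun _ : Fin n => ℝ) i).analyticAt z₀).pow _

/-- A property holding near the origin holds at some point with prescribed vanishing coordinates
and all the other coordinates nonzero. -/
theorem exists_point_of_eventually {n : ℕ} {Q : (Fin n → ℝ) → Prop}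
    (h : ∀ᶠ z in 𝓝 0, Q z) (S : Set (Fin n)) :
    ∃ z, Q z ∧ ∀ i, (z i = 0 ↔ i ∈ S) := by
  classical
  have hc : Tendsto (fun t : ℝ => fun i : Fin n => if i ∈ S then 0 else t) (𝓝[≠] 0) (𝓝 0) := by
    have : Continuous (fun t : ℝ => fun i : Fin n => if i ∈ S then 0 else t) := by
      refine continuous_pi fun i => ?_
      split_ifs <;> fun_prop
    have h0 := this.tendsto 0
    have e : (fun i : Fin n => if i ∈ S then 0 else (0 : ℝ)) = 0 := by ext; simp
    rw [e] at h0
    exact h0.mono_left nhdsWithin_le_nhds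
  obtain ⟨t, ht, ht0⟩ := ((hc.eventually h).and self_mem_nhdsWithin).exists
  refine ⟨_, ht, fun i => ?_⟩
  have : t ≠ 0 := ht0
  by_cases hi : i ∈ S <;> simp [hi, this]

theorem monomial_ne_zero {n : ℕ} {α : Fin n → ℕ} {z : Fin n → ℝ} (h : ∀ i, z i = 0 → α i = 0) :
    ∏ i, z i ^ α i ≠ 0 := by
  refine Finset.prod_ne_zero_iff.2 fun i _ => ?_
  by_cases hz : z i = 0
  · simp [h i hz]
  · exact pow_ne_zero _ hz

theorem not_eventually_monomial_eq_zero {n : ℕ} (α : Fin n → ℕ) :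
    ¬ ∀ᶠ z : Fin n → ℝ in 𝓝 0, ∏ i, z i ^ α i = 0 := by
  intro h
  obtain ⟨z, hz, hS⟩ := exists_point_of_eventually h ∅
  exact monomial_ne_zero (fun i hi => absurd ((hS i).1 hi) (Set.notMem_empty i)) hz

theorem isNormal_of_ne_zero {n : ℕ} {f : (Fin n → ℝ) → ℝ} (hf : AnalyticAt ℝ f 0) (h0 : f 0 ≠ 0) :
    IsNormal f := ⟨0, f, hf, h0, by simp⟩

theorem IsNormal.coord_mul {n : ℕ} {f g : (Fin n → ℝ) → ℝ} (hg : IsNormal g) (j : Fin n)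
    (h : ∀ᶠ z in 𝓝 0, f z = z j * g z) : IsNormal f := by
  obtain ⟨α, u, hu, hu0, hgu⟩ := hg
  refine ⟨α + Pi.single j 1, u, hu, hu0, ?_⟩
  filter_upwards [h, hgu] with z h1 h2
  rw [h1, h2]
  simp only [Pi.add_apply, pow_add, Finset.prod_mul_distrib]
  have : ∏ i, z i ^ (Pi.single j 1 : Fin n → ℕ) i = z j := by
    rw [Finset.prod_eq_single j] <;> simp +contextual
  rw [this]; ring

theorem monomial_eq_coord_mul {n : ℕ} {α : Fin n → ℕ} {j : Fin n} (hj : α j ≠ 0) (z : Fin n → ℝ) :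
    ∏ i, z i ^ α i = z j * ∏ i, z i ^ (α - Pi.single j 1 : Fin n → ℕ) i := by
  have h1 : α = (α - Pi.single j 1) + Pi.single j 1 := by
    ext i
    by_cases h : i = j
    · subst h; simp; omega
    · simp [h]
  have : ∏ i, z i ^ (Pi.single j 1 : Fin n → ℕ) i = z j := by
    rw [Finset.prod_eq_single j] <;> simp +contextual
  nth_rw 1 [h1]
  simp only [Pi.add_apply, pow_add, Finset.prod_mul_distrib]
  rw [this]; ring

theorem tendsto_update_zero {n : ℕ} (j : Fin n) :
    Tendsto (fun z : Fin n → ℝ => Function.update z j 0) (𝓝 0) (𝓝 0) := by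
  have : Continuous (fun z : Fin n → ℝ => Function.update z j 0) :=
    continuous_id.update j continuous_const
  simpa using this.tendsto 0

theorem analyticAt_comp_update {n : ℕ} {f : (Fin n → ℝ) → ℝ} (hf : AnalyticAt ℝ f 0) (j : Fin n) :
    AnalyticAt ℝ (fun z => f (Function.update z j 0)) 0 := by
  refine AnalyticAt.fun_comp_of_eq hf (f := fun z => Function.update z j 0) ?_ (by simp)
  refine AnalyticAt.pi fun i => ?_
  by_cases h : i = j
  · subst h; simpa using analyticAt_const
  · have e : (fun z : Fin n → ℝ => Function.update z j 0 i) = fun z => z i := by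
      ext; simp [h]
    rw [e]
    exact (ContinuousLinearMap.proj (R := ℝ) (φ := fun _ : Fin n => ℝ) i).analyticAt 0

theorem isNormal_of_mul_aux {n : ℕ} (N : ℕ) : ∀ (α : Fin n → ℕ) (f g u : (Fin n → ℝ) → ℝ),
    ∑ i, α i = N → AnalyticAt ℝ f 0 → AnalyticAt ℝ g 0 → AnalyticAt ℝ u 0 → u 0 ≠ 0 →
    (∀ᶠ z in 𝓝 0, f z * g z = (∏ i, z i ^ α i) * u z) → IsNormal f ∧ IsNormal g := by
  induction N with
  | zero =>
    intro α f g u hα hf hg hu hu0 h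
    have hα0 : ∀ i, α i = 0 := by simpa using hα
    have := h.self_of_nhds
    simp only [hα0, pow_zero, Finset.prod_const_one, one_mul] at this
    exact ⟨isNormal_of_ne_zero hf (left_ne_zero_of_mul (this ▸ hu0)),
      isNormal_of_ne_zero hg (right_ne_zero_of_mul (this ▸ hu0))⟩
  | succ N ih =>
    intro α f g u hα hf hg hu hu0 h
    obtain ⟨j, hj⟩ : ∃ j, α j ≠ 0 := by
      by_contra! hc
      simp [hc] at hα
    have hsum : ∑ i, (α - Pi.single j 1 : Fin n → ℕ) i = N := by
      have h1 : ∑ i, ((α - Pi.single j 1 : Fin n → ℕ) i + (Pi.single j 1 : Fin n → ℕ) i)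
          = ∑ i, α i := by
        refine Finset.sum_congr rfl fun i _ => ?_
        by_cases h : i = j
        · subst h; simp; omega
        · simp [h]
      rw [Finset.sum_add_distrib, hα] at h1
      simpa using h1
    have hzero : ∀ᶠ z : Fin n → ℝ in 𝓝 0,
        f (Function.update z j 0) * g (Function.update z j 0) = 0 := by
      filter_upwards [(tendsto_update_zero j).eventually h] with z hz
      rw [hz, Finset.prod_eq_zero (Finset.mem_univ j) (by simp [hj]), zero_mul]
    have hcoord : ¬ ∀ᶠ z : Fin n → ℝ in 𝓝 0, z j = 0 := by
      intro hc
      obtain ⟨z, hz, hS⟩ := exists_point_of_eventually hc ∅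
      exact absurd ((hS j).1 hz) (Set.notMem_empty j)
    have hpj : AnalyticAt ℝ (fun z : Fin n → ℝ => z j) 0 :=
      (ContinuousLinearMap.proj (R := ℝ) (φ := fun _ : Fin n => ℝ) j).analyticAt 0
    -- the case where the first factor is divisible by the coordinate
    have main : ∀ f g : (Fin n → ℝ) → ℝ, AnalyticAt ℝ f 0 → AnalyticAt ℝ g 0 →
        (∀ᶠ z in 𝓝 0, f z * g z = (∏ i, z i ^ α i) * u z) →
        (∀ᶠ z : Fin n → ℝ in 𝓝 0, f (Function.update z j 0) = 0) → IsNormal f ∧ IsNormal g := by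
      intro f g hf hg h hf0
      obtain ⟨k, hk, hfk⟩ := exists_div_coord hf j
      have hfk' : ∀ᶠ z in 𝓝 0, f z = z j * k z := by
        filter_upwards [hfk, hf0] with z h1 h2
        rw [h1, h2, zero_add]
      have h3 := eventually_eq_of_mul_left (f := fun z : Fin n → ℝ => z j)
        (g := fun z => k z * g z)
        (h := fun z => (∏ i, z i ^ (α - Pi.single j 1 : Fin n → ℕ) i) * u z) hpj (hk.mul hg)
        ((analyticAt_monomial _ _).mul hu) hcoord
        (by filter_upwards [h, hfk'] with z h1 h2
            rw [h2, monomial_eq_coord_mul hj] at h1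
            linarith)
      obtain ⟨hkn, hgn⟩ := ih _ k g u hsum hk hg hu hu0 h3
      exact ⟨hkn.coord_mul j hfk', hgn⟩
    rcases eventually_zero_of_mul (analyticAt_comp_update hf j) (analyticAt_comp_update hg j) hzero
      with h1 | h1
    · exact main f g hf hg h h1
    · exact (main g f hg hf (h.mono fun z hz => by rw [mul_comm, hz]) h1).symm

/-- Factors of a normal crossing are normal crossings. -/
theorem IsNormal.of_mul {n : ℕ} {f g : (Fin n → ℝ) → ℝ} (hf : AnalyticAt ℝ f 0)
    (hg : AnalyticAt ℝ g 0) (h : IsNormal (fun z => f z * g z)) : IsNormal f ∧ IsNormal g := by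
  obtain ⟨α, u, hu, hu0, hfu⟩ := h
  exact isNormal_of_mul_aux _ α f g u rfl hf hg hu hu0 hfu

theorem IsNormal.of_prod {n : ℕ} {ι : Type*} {s : Finset ι} {f : ι → (Fin n → ℝ) → ℝ}
    (hf : ∀ i ∈ s, AnalyticAt ℝ (f i) 0) (h : IsNormal (fun z => ∏ i ∈ s, f i z)) {i : ι}
    (hi : i ∈ s) : IsNormal (f i) := by
  classical
  have : (fun z => ∏ i ∈ s, f i z) = fun z => f i z * ∏ i ∈ s.erase i, f i z := by
    ext z; rw [Finset.mul_prod_erase s (fun i => f i z) hi]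
  rw [this] at h
  exact (h.of_mul (hf i hi)
    (Finset.analyticAt_fun_prod _ fun k hk => hf k (Finset.mem_of_mem_erase hk))).1

/-- If the difference of two normal crossings is normal crossing or zero, then one of the two
monomials divides the other. -/
theorem le_or_le_of_sub {n : ℕ} {α β : Fin n → ℕ} {u v : (Fin n → ℝ) → ℝ}
    (hu : AnalyticAt ℝ u 0) (hu0 : u 0 ≠ 0) (hv : AnalyticAt ℝ v 0) (hv0 : v 0 ≠ 0)
    (h : (∀ᶠ z in 𝓝 0, (∏ i, z i ^ α i) * u z - (∏ i, z i ^ β i) * v z = 0) ∨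
      IsNormal (fun z => (∏ i, z i ^ α i) * u z - (∏ i, z i ^ β i) * v z)) :
    α ≤ β ∨ β ≤ α := by
  by_contra! hc
  obtain ⟨hαβ, hβα⟩ := hc
  simp only [Pi.le_def, not_forall, not_le] at hαβ hβα
  obtain ⟨k, hk⟩ := hαβ
  obtain ⟨l, hl⟩ := hβα
  let w : (Fin n → ℝ) → ℝ := fun z =>
    (∏ i, z i ^ (α i - min (α i) (β i))) * u z - (∏ i, z i ^ (β i - min (α i) (β i))) * v z
  have hw : AnalyticAt ℝ w 0 :=
    ((analyticAt_monomial _ _).mul hu).sub ((analyticAt_monomial _ _).mul hv)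
  have hfac : ∀ z, (∏ i, z i ^ α i) * u z - (∏ i, z i ^ β i) * v z
      = (∏ i, z i ^ min (α i) (β i)) * w z := by
    intro z
    have h1 : ∏ i, z i ^ α i
        = (∏ i, z i ^ min (α i) (β i)) * ∏ i, z i ^ (α i - min (α i) (β i)) := by
      rw [← Finset.prod_mul_distrib]
      refine Finset.prod_congr rfl fun i _ => ?_
      rw [← pow_add]; congr 1; omega
    have h2 : ∏ i, z i ^ β i
        = (∏ i, z i ^ min (α i) (β i)) * ∏ i, z i ^ (β i - min (α i) (β i)) := by
      rw [← Finset.prod_mul_distrib]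
      refine Finset.prod_congr rfl fun i _ => ?_
      rw [← pow_add]; congr 1; omega
    simp only [w]; rw [h1, h2]; ring
  simp only [hfac] at h
  -- in both cases `w` vanishes on a coordinate hyperplane
  have hvan : ∃ j, ∀ᶠ z : Fin n → ℝ in 𝓝 0, z j = 0 → w z = 0 := by
    rcases h with h | h
    · have := (eventually_zero_of_mul (analyticAt_monomial _ _) hw h).resolve_left
        (not_eventually_monomial_eq_zero _)
      exact ⟨k, this.mono fun z hz _ => hz⟩
    · obtain ⟨γ, w', hw', hw0', hww⟩ := (h.of_mul (analyticAt_monomial _ _) hw).2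
      have hw00 : w 0 = 0 := by
        simp only [w]
        rw [Finset.prod_eq_zero (Finset.mem_univ k), Finset.prod_eq_zero (Finset.mem_univ l)]
        · ring
        · exact zero_pow (by omega)
        · exact zero_pow (by omega)
      have h3 := hww.self_of_nhds
      rw [hw00] at h3
      have h4 := (mul_eq_zero.1 h3.symm).resolve_right hw0'
      obtain ⟨j, -, hj⟩ := Finset.prod_eq_zero_iff.1 h4
      have hj' : γ j ≠ 0 := fun h0 => by simp [h0] at hj
      refine ⟨j, hww.mono fun z hz hzj => ?_⟩
      rw [hz, Finset.prod_eq_zero (Finset.mem_univ j) (by rw [hzj]; exact zero_pow hj'), zero_mul]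
  obtain ⟨j, hj⟩ := hvan
  have hev := hj.and ((hu.continuousAt.eventually_ne hu0).and (hv.continuousAt.eventually_ne hv0))
  rcases le_total (α j) (β j) with hle | hle
  · obtain ⟨z, ⟨hz, hzu, -⟩, hS⟩ := exists_point_of_eventually hev {j, l}
    have h0 := hz ((hS j).2 (by simp))
    simp only [w] at h0
    rw [Finset.prod_eq_zero (f := fun i => z i ^ (β i - min (α i) (β i))) (Finset.mem_univ l),
      zero_mul, sub_zero] at h0
    · refine (mul_ne_zero (monomial_ne_zero fun i hi => ?_) hzu) h0
      rcases (hS i).1 hi with rfl | hi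
      · omega
      · rw [Set.mem_singleton_iff.1 hi]; omega
    · simp only [(hS l).2 (by simp : l ∈ ({j, l} : Set (Fin n)))]
      exact zero_pow (by omega)
  · obtain ⟨z, ⟨hz, -, hzv⟩, hS⟩ := exists_point_of_eventually hev {j, k}
    have h0 := hz ((hS j).2 (by simp))
    simp only [w] at h0
    rw [Finset.prod_eq_zero (f := fun i => z i ^ (α i - min (α i) (β i))) (Finset.mem_univ k),
      zero_mul, zero_sub, neg_eq_zero] at h0
    · refine (mul_ne_zero (monomial_ne_zero fun i hi => ?_) hzv) h0
      rcases (hS i).1 hi with rfl | hi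
      · omega
      · rw [Set.mem_singleton_iff.1 hi]; omega
    · simp only [(hS k).2 (by simp : k ∈ ({j, k} : Set (Fin n)))]
      exact zero_pow (by omega)

end AnalyticGerm

namespace AnalyticGerm

/-- The monomial function with exponent `α`. -/
def mon {n : ℕ} (α : Fin n → ℕ) (x : Fin n → ℝ) : ℝ := ∏ i, x i ^ α i

section mon

variable {n : ℕ} (α β : Fin n → ℕ) (x y : Fin n → ℝ)

theorem mon_zero : mon 0 x = 1 := by simp [mon]

theorem mon_add : mon (α + β) x = mon α x * mon β x := by
  simp [mon, pow_add, Finset.prod_mul_distrib]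

theorem mon_nsmul (k : ℕ) : mon (k • α) x = mon α x ^ k := by
  simp [mon, ← Finset.prod_pow, ← pow_mul, mul_comm]

theorem mon_mul : mon α (fun i => x i * y i) = mon α x * mon α y := by
  simp [mon, mul_pow, Finset.prod_mul_distrib]

theorem mon_pow (k : ℕ) : mon α (fun i => x i ^ k) = mon (k • α) x := by
  simp [mon, ← pow_mul]

theorem mon_single (j : Fin n) (k : ℕ) : mon (Pi.single j k) x = x j ^ k := by
  rw [mon, Finset.prod_eq_single j] <;> simp +contextual

theorem mon_at_zero {α : Fin n → ℕ} (h : α ≠ 0) : mon α 0 = 0 := by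
  obtain ⟨i, hi⟩ := Function.ne_iff.1 h
  exact Finset.prod_eq_zero (Finset.mem_univ i) (by simpa using hi)

theorem mon_update (j : Fin n) (c : ℝ) :
    mon α (Function.update x j (c * x j)) = c ^ α j * mon α x := by
  have : Function.update x j (c * x j) = fun i => Function.update (1 : Fin n → ℝ) j c i * x i := by
    ext i
    by_cases h : i = j
    · subst h; simp
    · simp [h]
  rw [this, mon_mul]
  congr 1
  rw [mon, Finset.prod_eq_single j] <;> simp +contextual

theorem mon_sub_single {α : Fin n → ℕ} {j : Fin n} (hj : α j ≠ 0) :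
    mon α x = x j * mon (α - Pi.single j 1) x := monomial_eq_coord_mul hj x

theorem mon_of_le {α β : Fin n → ℕ} (h : α ≤ β) : mon β x = mon α x * mon (β - α) x := by
  rw [← mon_add, add_tsub_cancel_of_le h]

theorem mon_ne_zero {α : Fin n → ℕ} {x : Fin n → ℝ} (h : ∀ i, x i ≠ 0) : mon α x ≠ 0 :=
  Finset.prod_ne_zero_iff.2 fun i _ => pow_ne_zero _ (h i)

variable {E : Type*} [NormedAddCommGroup E] [NormedSpace ℝ E]

@[fun_prop]
theorem analyticAt_mon {f : E → Fin n → ℝ} {z : E} (hf : AnalyticAt ℝ f z) :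
    AnalyticAt ℝ (fun z => mon α (f z)) z :=
  AnalyticAt.fun_comp (g := mon α) (analyticAt_monomial α (f z)) hf

end mon

section lift

variable {Ω : Type*} (𝒰 : Ultrafilter Ω)
  {E F G : Type*} [NormedAddCommGroup E] [NormedSpace ℝ E] [NormedAddCommGroup F] [NormedSpace ℝ F]
  [NormedAddCommGroup G] [NormedSpace ℝ G]

/-- The path `q` in `F` lifts the path `p` in `E` along the analytic germ `g`. -/
def Lifts (p : Ω → E) (g : F → E) (q : Ω → F) : Prop :=
  AnalyticAt ℝ g 0 ∧ g 0 = 0 ∧ Tendsto q 𝒰 (𝓝 0) ∧ ∀ᶠ ω in 𝒰, g (q ω) = p ω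

/-- Along the path `p`, the germ `f` can be pulled back to a normal crossing in `n` variables. -/
def Res (n : ℕ) (p : Ω → E) (f : E → ℝ) : Prop :=
  ∃ (g : (Fin n → ℝ) → E) (q : Ω → Fin n → ℝ), Lifts 𝒰 p g q ∧ IsNormal (fun z => f (g z))

variable {𝒰}

theorem Lifts.tendsto {p : Ω → E} {g : F → E} {q : Ω → F} (h : Lifts 𝒰 p g q) :
    Tendsto g (𝓝 0) (𝓝 0) := by
  simpa [h.2.1] using h.1.continuousAt.tendsto

theorem Lifts.comp {p : Ω → E} {g : F → E} {q : Ω → F} {h : G → F} {r : Ω → G}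
    (h1 : Lifts 𝒰 p g q) (h2 : Lifts 𝒰 q h r) : Lifts 𝒰 p (fun z => g (h z)) r := by
  refine ⟨AnalyticAt.fun_comp_of_eq h1.1 h2.1 h2.2.1, by simp only [h2.2.1, h1.2.1], h2.2.2.1, ?_⟩
  filter_upwards [h1.2.2.2, h2.2.2.2] with ω e1 e2
  rw [e2, e1]

theorem Lifts.analyticAt_comp {p : Ω → E} {g : F → E} {q : Ω → F} (h : Lifts 𝒰 p g q)
    {f : E → G} (hf : AnalyticAt ℝ f 0) : AnalyticAt ℝ (fun z => f (g z)) 0 :=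
  AnalyticAt.fun_comp_of_eq hf h.1 h.2.1

variable {n : ℕ}

theorem Res.of_lifts {p : Ω → E} {g : F → E} {q : Ω → F} {f : E → ℝ} (h : Lifts 𝒰 p g q)
    (hr : Res 𝒰 n q (fun z => f (g z))) : Res 𝒰 n p f := by
  obtain ⟨k, r, hk, hn⟩ := hr
  exact ⟨_, r, h.comp hk, hn⟩

theorem IsNormal.congr {f f' : (Fin n → ℝ) → ℝ} (hf : IsNormal f) (h : ∀ᶠ z in 𝓝 0, f' z = f z) :
    IsNormal f' := by
  obtain ⟨α, u, hu, hu0, e⟩ := hf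
  exact ⟨α, u, hu, hu0, by filter_upwards [h, e] with z h1 h2; rw [h1, h2]⟩

theorem IsNormal.mul {f f' : (Fin n → ℝ) → ℝ} (hf : IsNormal f) (hf' : IsNormal f') :
    IsNormal (fun z => f z * f' z) := by
  obtain ⟨α, u, hu, hu0, e⟩ := hf
  obtain ⟨α', u', hu', hu0', e'⟩ := hf'
  refine ⟨α + α', fun z => u z * u' z, hu.mul hu', mul_ne_zero hu0 hu0', ?_⟩
  filter_upwards [e, e'] with z h h'
  have := mon_add α α' z
  simp only [mon] at this
  rw [h, h', this]; ring

theorem IsNormal.pow {f : (Fin n → ℝ) → ℝ} (hf : IsNormal f) (k : ℕ) :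
    IsNormal (fun z => f z ^ k) := by
  induction k with
  | zero => simpa using isNormal_of_ne_zero (n := n) analyticAt_const one_ne_zero
  | succ k ih => simpa [pow_succ] using ih.mul hf

theorem Res.congr {p : Ω → E} {f f' : E → ℝ} (hr : Res 𝒰 n p f)
    (h : ∀ᶠ z in 𝓝 0, f' z = f z) : Res 𝒰 n p f' := by
  obtain ⟨g, q, hg, hn⟩ := hr
  exact ⟨g, q, hg, hn.congr (hg.tendsto.eventually h)⟩

theorem Res.mul_unit {p : Ω → E} {f w : E → ℝ} (hr : Res 𝒰 n p f) (hw : AnalyticAt ℝ w 0)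
    (hw0 : w 0 ≠ 0) : Res 𝒰 n p (fun z => f z * w z) := by
  obtain ⟨g, q, hg, hn⟩ := hr
  exact ⟨g, q, hg, hn.mul (isNormal_of_ne_zero (hg.analyticAt_comp hw) (by rwa [hg.2.1]))⟩

/-- Splitting off the last coordinate. -/
noncomputable def snocEquiv (n : ℕ) : ((Fin n → ℝ) × ℝ) ≃L[ℝ] (Fin (n + 1) → ℝ) :=
  LinearEquiv.toContinuousLinearEquiv
    { toFun := fun z => Fin.snoc (α := fun _ => ℝ) z.1 z.2
      invFun := fun x => (fun i => x i.castSucc, x (Fin.last n))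
      left_inv := fun z => by ext <;> simp
      right_inv := fun x => by
        ext i
        refine Fin.lastCases ?_ (fun i => ?_) i <;> simp
      map_add' := fun z w => by
        ext i
        refine Fin.lastCases ?_ (fun i => ?_) i <;> simp
      map_smul' := fun c z => by
        ext i
        refine Fin.lastCases ?_ (fun i => ?_) i <;> simp }

theorem snocEquiv_symm_apply (x : Fin (n + 1) → ℝ) :
    (snocEquiv n).symm x = (fun i => x i.castSucc, x (Fin.last n)) := rfl

theorem Lifts.of_equiv {p : Ω → E} (hp : Tendsto p 𝒰 (𝓝 0)) (e : F ≃L[ℝ] E) :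
    Lifts 𝒰 p e (fun ω => e.symm (p ω)) := by
  refine ⟨(e : F →L[ℝ] E).analyticAt 0, e.map_zero, ?_, by simp⟩
  have := (e.symm.continuous.tendsto 0).comp hp
  rwa [map_zero] at this

theorem Res.of_monomial {p : Ω → (Fin n → ℝ) × ℝ} (hp : Tendsto p 𝒰 (𝓝 0))
    {f : (Fin n → ℝ) × ℝ → ℝ} {α : Fin n → ℕ} {k : ℕ} {u : (Fin n → ℝ) × ℝ → ℝ}
    (hu : AnalyticAt ℝ u 0) (hu0 : u 0 ≠ 0)
    (h : ∀ᶠ z in 𝓝 0, f z = mon α z.1 * z.2 ^ k * u z) : Res 𝒰 (n + 1) p f := by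
  have hl := Lifts.of_equiv hp (snocEquiv n).symm
  refine ⟨_, _, hl, Fin.snoc (α := fun _ => ℕ) α k, _, hl.analyticAt_comp hu,
    by simpa using hu0, ?_⟩
  filter_upwards [hl.tendsto.eventually h] with z hz
  rw [hz, Fin.prod_univ_castSucc]
  simp [mon, snocEquiv_symm_apply]

/-- A lift in the parameter space induces a lift of the product with a line. -/
theorem Lifts.prodMap {p : Ω → E × ℝ} (hp : Tendsto p 𝒰 (𝓝 0)) {g : F → E} {q : Ω → F}
    (h : Lifts 𝒰 (fun ω => (p ω).1) g q) :
    Lifts 𝒰 p (fun z : F × ℝ => (g z.1, z.2)) (fun ω => (q ω, (p ω).2)) := by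
  refine ⟨?_, by simp [h.2.1], ?_, ?_⟩
  · have : AnalyticAt ℝ (fun z : F × ℝ => g z.1) 0 :=
      AnalyticAt.fun_comp_of_eq h.1 (f := fun z : F × ℝ => z.1) analyticAt_fst rfl
    exact this.prod analyticAt_snd
  · exact h.2.2.1.prodMk_nhds ((continuous_snd.tendsto _).comp hp)
  · filter_upwards [h.2.2.2] with ω e
    simp [e]

/-- Ramification along the coordinates. -/
theorem exists_lifts_ramify {p : Ω → Fin n → ℝ} (hp : Tendsto p 𝒰 (𝓝 0)) {D : ℕ} (hD : D ≠ 0) :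
    ∃ ε : Fin n → ℝ, (∀ i, ε i ≠ 0) ∧
      ∃ q, Lifts 𝒰 p (fun (x : Fin n → ℝ) i => ε i * x i ^ D) q := by
  have hs : ∀ i, ∃ ε : ℝ, ε ≠ 0 ∧ ∀ᶠ ω in 𝒰, ε * |p ω i| = p ω i := by
    intro i
    rcases Ultrafilter.eventually_or.1
      (Eventually.of_forall (f := (𝒰 : Filter Ω)) fun ω => le_total 0 (p ω i)) with h | h
    · exact ⟨1, one_ne_zero, h.mono fun ω hω => by rw [abs_of_nonneg hω, one_mul]⟩
    · exact ⟨-1, by norm_num, h.mono fun ω hω => by rw [abs_of_nonpos hω]; ring⟩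
  choose ε hε hεp using hs
  refine ⟨ε, hε, fun ω i => |p ω i| ^ ((D : ℝ)⁻¹), ?_, ?_, ?_, ?_⟩
  · exact AnalyticAt.pi fun i => analyticAt_const.mul
      (((ContinuousLinearMap.proj (R := ℝ) (φ := fun _ : Fin n => ℝ) i).analyticAt 0).pow D)
  · ext i; simp [hD]
  · refine tendsto_pi_nhds.2 fun i => ?_
    have h1 : Tendsto (fun ω => |p ω i|) 𝒰 (𝓝 0) := by
      simpa using ((tendsto_pi_nhds.1 hp) i).abs
    have h2 := h1.rpow_const (p := (D : ℝ)⁻¹) (Or.inr (by positivity))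
    simpa [Real.zero_rpow (inv_ne_zero (Nat.cast_ne_zero.2 hD))] using h2
  · filter_upwards [eventually_all.2 hεp] with ω h
    ext i
    rw [Real.rpow_inv_natCast_pow (abs_nonneg _) hD, h]

end lift

end AnalyticGerm

namespace AnalyticGerm

variable {E : Type*} [NormedAddCommGroup E] [NormedSpace ℝ E]

/-- `F` has order exactly `d` in the last variable. -/
def RegOrder (d : ℕ) (F : E × ℝ → ℝ) : Prop :=
  ∃ v : ℝ → ℝ, AnalyticAt ℝ v 0 ∧ v 0 ≠ 0 ∧ ∀ᶠ y in 𝓝 0, F (0, y) = y ^ d * v y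

open Polynomial in
/-- A polynomial of degree `d` without term of degree `d - 1` which is not a monomial has only
roots of multiplicity less than `d`. -/
theorem exists_root_order_lt {d : ℕ} {c : ℕ → ℝ} {u₀ : ℝ} (hu : u₀ ≠ 0) (hc : c (d - 1) = 0)
    {i₀ : ℕ} (hi₀ : i₀ < d) (hci : c i₀ ≠ 0) (l : ℝ) :
    ∃ d' < d, ∃ v : ℝ → ℝ, AnalyticAt ℝ v 0 ∧ v 0 ≠ 0 ∧
      ∀ y, ∑ i ∈ Finset.range d, c i * (l + y) ^ i + (l + y) ^ d * u₀ = y ^ d' * v y := by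
  let P : ℝ[X] := ∑ i ∈ Finset.range d, C (c i) * X ^ i + C u₀ * X ^ d
  have hcoeff : ∀ k < d, P.coeff k = c k := by
    intro k hk
    simp [P, coeff_X_pow, hk, hk.ne]
  have hcoeffd : P.coeff d = u₀ := by
    simp [P, coeff_X_pow]
  have hP0 : P ≠ 0 := fun h => hu (by rw [← hcoeffd, h, coeff_zero])
  have hdeg : P.natDegree ≤ d := by
    refine natDegree_add_le_of_degree_le (natDegree_sum_le_of_forall_le _ _ fun i hi => ?_) ?_
    · exact (natDegree_C_mul_X_pow_le _ _).trans (Finset.mem_range.1 hi).le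
    · exact natDegree_C_mul_X_pow_le _ _
  obtain ⟨R, hR, hndvd⟩ := P.exists_eq_pow_rootMultiplicity_mul_and_not_dvd hP0 l
  set m := P.rootMultiplicity l
  have hRl : R.eval l ≠ 0 := fun h => hndvd (dvd_iff_isRoot.2 h)
  have hR0 : R ≠ 0 := fun h => hRl (by simp [h])
  have hmd : m + R.natDegree ≤ d := by
    rw [hR, natDegree_mul (pow_ne_zero _ (X_sub_C_ne_zero l)) hR0, natDegree_pow,
      natDegree_X_sub_C, mul_one] at hdeg
    exact hdeg
  refine ⟨m, lt_of_le_of_ne (by omega) fun hm => ?_, fun y => R.eval (l + y), ?_, by simpa, ?_⟩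
  · obtain ⟨r, hr⟩ : ∃ r, R = C r := ⟨_, eq_C_of_natDegree_eq_zero (by omega)⟩
    rw [hr] at hRl
    have hr0 : r ≠ 0 := by simpa using hRl
    have h1 : ∀ k, P.coeff k = (-l) ^ (d - k) * d.choose k * r := by
      intro k
      rw [hR, hr, hm, coeff_mul_C, sub_eq_add_neg, ← C_neg, coeff_X_add_C_pow]
    have h2 := hcoeff (d - 1) (by omega)
    rw [h1, hc] at h2
    have h3 : d - (d - 1) = 1 := by omega
    have h4 : (d.choose (d - 1) : ℝ) ≠ 0 := by
      exact_mod_cast (Nat.choose_pos (by omega)).ne'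
    have h5 : l = 0 := by
      rw [h3] at h2
      simpa [h4, hr0] using h2
    have h6 := hcoeff i₀ hi₀
    rw [h1, h5, neg_zero, zero_pow (by omega), zero_mul, zero_mul] at h6
    exact hci h6.symm
  · have h1 : AnalyticAt ℝ (fun x : ℝ => R.eval x) (l + 0) := by
      simpa using analyticAt_id.aeval_polynomial (𝕜 := ℝ) (A := ℝ) (z := l + 0) R
    exact AnalyticAt.fun_comp (f := fun y : ℝ => l + y) h1 (by fun_prop)
  · intro y
    have : P.eval (l + y) = y ^ m * R.eval (l + y) := by
      conv_lhs => rw [hR]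
      simp
    rw [← this]
    simp only [P, eval_add, eval_finsetSum, eval_mul, eval_C, eval_pow, eval_X]
    ring

theorem analyticAt_comp_fst {a : E → ℝ} (ha : AnalyticAt ℝ a 0) :
    AnalyticAt ℝ (fun z : E × ℝ => a z.1) 0 :=
  AnalyticAt.fun_comp_of_eq ha (f := fun z : E × ℝ => z.1) analyticAt_fst rfl

/-- Polynomial in the last variable, quasi-homogeneous with weight `β`, plus a remainder. -/
def weighted {n : ℕ} (d : ℕ) (β : Fin n → ℕ) (a : ℕ → (Fin n → ℝ) → ℝ) (u : (Fin n → ℝ) × ℝ → ℝ)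
    (z : (Fin n → ℝ) × ℝ) : ℝ :=
  ∑ i ∈ Finset.range d, mon β z.1 ^ (d - i) * a i z.1 * z.2 ^ i + z.2 ^ d * u z

theorem analyticAt_coord {n : ℕ} (j : Fin n) (z : Fin n → ℝ) :
    AnalyticAt ℝ (fun x : Fin n → ℝ => x j) z :=
  (ContinuousLinearMap.proj (R := ℝ) (φ := fun _ : Fin n => ℝ) j).analyticAt z

theorem analyticAt_fst_coord {n : ℕ} (j : Fin n) (z : (Fin n → ℝ) × ℝ) :
    AnalyticAt ℝ (fun x : (Fin n → ℝ) × ℝ => x.1 j) z :=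
  ((ContinuousLinearMap.proj (R := ℝ) (φ := fun _ : Fin n => ℝ) j).comp
    (ContinuousLinearMap.fst ℝ (Fin n → ℝ) ℝ)).analyticAt z

section blowup

variable {Ω : Type*} {𝒰 : Ultrafilter Ω} {n : ℕ}

theorem exists_lifts_chart_fst {p : Ω → (Fin n → ℝ) × ℝ} (hp : Tendsto p 𝒰 (𝓝 0)) (j : Fin n)
    {M : ℝ} (hM : ∀ᶠ w in 𝒰, |(p w).2| ≤ M * |(p w).1 j|) :
    ∃ l : ℝ, ∃ q, Lifts 𝒰 p (fun z : (Fin n → ℝ) × ℝ => (z.1, z.1 j * (l + z.2))) q := by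
  have hb : ∀ᶠ w in 𝒰, (p w).2 / (p w).1 j ∈ Icc (-|M|) |M| := by
    filter_upwards [hM] with w hw
    refine abs_le.1 ?_
    rcases eq_or_ne ((p w).1 j) 0 with h | h
    · simp [h]
    · rw [abs_div, div_le_iff₀ (abs_pos.2 h)]
      exact hw.trans (by gcongr; exact le_abs_self M)
  obtain ⟨l, -, hl⟩ := isCompact_Icc.ultrafilter_le_nhds
    (𝒰.map fun w => (p w).2 / (p w).1 j) (le_principal_iff.2 hb)
  have hl' : Tendsto (fun w => (p w).2 / (p w).1 j) 𝒰 (𝓝 l) := hl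
  refine ⟨l, fun w => ((p w).1, (p w).2 / (p w).1 j - l), ?_, by simp, ?_, ?_⟩
  · exact analyticAt_fst.prod
      ((analyticAt_fst_coord j 0).mul (analyticAt_const.add analyticAt_snd))
  · have h1 : Tendsto (fun w => (p w).1) 𝒰 (𝓝 0) := (continuous_fst.tendsto _).comp hp
    have h2 := hl'.sub_const l
    rw [sub_self] at h2
    exact h1.prodMk_nhds h2
  · filter_upwards [hM] with w hw
    ext
    · rfl
    · rcases eq_or_ne ((p w).1 j) 0 with h | h
      · rw [h, abs_zero, mul_zero] at hw
        simp [h, abs_nonpos_iff.1 hw]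
      · simp only [add_sub_cancel]
        field_simp

theorem exists_lifts_chart_snd {p : Ω → (Fin n → ℝ) × ℝ} (hp : Tendsto p 𝒰 (𝓝 0)) (j : Fin n)
    (hM : ∀ M : ℝ, ∀ᶠ w in 𝒰, M * |(p w).1 j| < |(p w).2|) :
    ∃ q, Lifts 𝒰 p
      (fun z : (Fin n → ℝ) × ℝ => (Function.update z.1 j (z.2 * z.1 j), z.2)) q := by
  have hp1 : Tendsto (fun w => (p w).1) 𝒰 (𝓝 0) := (continuous_fst.tendsto _).comp hp
  have hp2 : Tendsto (fun w => (p w).2) 𝒰 (𝓝 0) := (continuous_snd.tendsto _).comp hp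
  have hl : Tendsto (fun w => (p w).1 j / (p w).2) 𝒰 (𝓝 0) := by
    rw [Metric.tendsto_nhds]
    intro e he
    filter_upwards [hM e⁻¹, hM 0] with w h h0
    rw [zero_mul] at h0
    rw [dist_zero_right, Real.norm_eq_abs, abs_div, div_lt_iff₀ h0]
    rwa [inv_mul_lt_iff₀ he] at h
  refine ⟨fun w => (Function.update (p w).1 j ((p w).1 j / (p w).2), (p w).2), ?_, ?_, ?_, ?_⟩
  · refine AnalyticAt.prod (AnalyticAt.pi fun i => ?_) analyticAt_snd
    by_cases h : i = j
    · subst h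
      simpa using (analyticAt_snd (E := Fin n → ℝ) (F := ℝ)).fun_mul (analyticAt_fst_coord i 0)
    · simpa [h] using analyticAt_fst_coord i 0
  · ext i <;> simp
  · refine Tendsto.prodMk_nhds (tendsto_pi_nhds.2 fun i => ?_) hp2
    by_cases h : i = j
    · subst h; simpa using hl
    · simpa [h] using (tendsto_pi_nhds.1 hp1) i
  · filter_upwards [hM 0] with w h0
    rw [zero_mul] at h0
    ext i
    · by_cases h : i = j
      · subst h; simp [mul_div_cancel₀ _ (abs_pos.1 h0)]
      · simp [h]
    · rfl

theorem weighted_chart_fst {d : ℕ} {β : Fin n → ℕ} {a : ℕ → (Fin n → ℝ) → ℝ}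
    {u : (Fin n → ℝ) × ℝ → ℝ} {j : Fin n} (hj : β j ≠ 0) (x : Fin n → ℝ) (y : ℝ) :
    weighted d β a u (x, x j * y) =
      x j ^ d * weighted d (β - Pi.single j 1) a (fun _ => u (x, x j * y)) (x, y) := by
  simp only [weighted, mul_add, Finset.mul_sum]
  congr 1
  · refine Finset.sum_congr rfl fun i hi => ?_
    have hd : d = (d - i) + i := by have := Finset.mem_range.1 hi; omega
    rw [mon_sub_single x hj]
    nth_rw 2 [hd]
    ring
  · ring

/-- Blowing up resolves quasi-homogeneous polynomials in the last variable, given that functions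
of smaller order can be resolved. -/
theorem res_weighted {d : ℕ}
    (hIH : ∀ d' < d, ∀ (γ : Fin n → ℕ) (F : (Fin n → ℝ) × ℝ → ℝ) (p : Ω → (Fin n → ℝ) × ℝ),
      AnalyticAt ℝ F 0 → RegOrder d' F → Tendsto p 𝒰 (𝓝 0) →
      Res 𝒰 (n + 1) p (fun z => mon γ z.1 * F z))
    {a : ℕ → (Fin n → ℝ) → ℝ} (ha : ∀ i, AnalyticAt ℝ (a i) 0) (had : a (d - 1) 0 = 0)
    {i₀ : ℕ} (hi₀ : i₀ < d) (hai₀ : a i₀ 0 ≠ 0) (N : ℕ) :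
    ∀ (β γ : Fin n → ℕ) (u : (Fin n → ℝ) × ℝ → ℝ) (p : Ω → (Fin n → ℝ) × ℝ),
      ∑ l, β l = N → β ≠ 0 → AnalyticAt ℝ u 0 → u 0 ≠ 0 → Tendsto p 𝒰 (𝓝 0) →
      Res 𝒰 (n + 1) p (fun z => mon γ z.1 * weighted d β a u z) := by
  induction N using Nat.strong_induction_on with
  | _ N ih =>
  intro β γ u p hN hβ hu hu0 hp
  obtain ⟨j, hj⟩ := Function.ne_iff.1 hβ
  change β j ≠ 0 at hj
  by_cases hM : ∃ M : ℝ, ∀ᶠ w in 𝒰, |(p w).2| ≤ M * |(p w).1 j|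
  · obtain ⟨M, hM⟩ := hM
    obtain ⟨l, q, hq⟩ := exists_lifts_chart_fst hp j hM
    refine Res.of_lifts hq ?_
    let u' : (Fin n → ℝ) × ℝ → ℝ := fun z => u (z.1, z.1 j * (l + z.2))
    have hu' : AnalyticAt ℝ u' 0 := hq.analyticAt_comp hu
    have hu0' : u' 0 ≠ 0 := by simpa [u', ← Prod.zero_eq_mk] using hu0
    let γ' : Fin n → ℕ := γ + Pi.single j d
    let G : (Fin n → ℝ) × ℝ → ℝ := fun z =>
      weighted d (β - Pi.single j 1) a (fun _ => u' z) (z.1, l + z.2)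
    have hG : AnalyticAt ℝ G 0 := by
      refine (Finset.analyticAt_fun_sum _ fun i _ => ?_).fun_add
        (((analyticAt_const.add analyticAt_snd).pow d).mul hu')
      exact (((analyticAt_mon _ analyticAt_fst).pow _).mul (analyticAt_comp_fst (ha i))).mul
        ((analyticAt_const.add analyticAt_snd).pow i)
    refine Res.congr (f := fun z => mon γ' z.1 * G z) ?_ (Eventually.of_forall fun z => ?_)
    · by_cases hβj : β - Pi.single j 1 = 0
      · obtain ⟨d', hd', v, hv, hv0, hG'⟩ := exists_root_order_lt (c := fun i => a i 0)
          (u₀ := u 0) hu0 had hi₀ hai₀ l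
        refine hIH d' hd' γ' G q hG ⟨v, hv, hv0, Eventually.of_forall fun y => ?_⟩ hq.2.2.1
        rw [← hG' y]
        simp [G, weighted, hβj, mon_zero, u', ← Prod.zero_eq_mk]
      · rcases eq_or_ne l 0 with rfl | hl
        · refine (ih (∑ l, (β - Pi.single j 1 : Fin n → ℕ) l) ?_ (β - Pi.single j 1) γ' u' q rfl
            hβj hu' hu0'
            hq.2.2.1).congr (Eventually.of_forall fun z => by simp [G, weighted])
          rw [← hN]
          refine Finset.sum_lt_sum (fun i _ => by simp) ⟨j, Finset.mem_univ j, ?_⟩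
          simp; omega
        · refine Res.of_monomial (α := γ') (k := 0) hq.2.2.1 hG ?_
            (Eventually.of_forall fun z => by simp)
          have : ∀ i ∈ Finset.range d, (0 : ℝ) ^ (d - i) * a i 0 * l ^ i = 0 := fun i hi => by
            have := Finset.mem_range.1 hi
            rw [zero_pow (by omega)]; ring
          simp only [G, weighted, Prod.fst_zero, Prod.snd_zero, mon_at_zero hβj, add_zero]
          rw [Finset.sum_eq_zero this, zero_add]
          exact mul_ne_zero (pow_ne_zero _ hl) hu0'
    · simp only [γ', G, mon_add, mon_single]
      rw [weighted_chart_fst hj]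
      ring
  · have hM' : ∀ M : ℝ, ∀ᶠ w in 𝒰, M * |(p w).1 j| < |(p w).2| := by
      intro M
      have h := not_exists.1 hM M
      rw [← Ultrafilter.eventually_not] at h
      exact h.mono fun w hw => not_le.1 hw
    obtain ⟨q, hq⟩ := exists_lifts_chart_snd hp j hM'
    refine Res.of_lifts hq ?_
    let g : (Fin n → ℝ) × ℝ → (Fin n → ℝ) × ℝ :=
      fun z => (Function.update z.1 j (z.2 * z.1 j), z.2)
    let U : (Fin n → ℝ) × ℝ → ℝ := fun z =>
      ∑ i ∈ Finset.range d, (mon β z.1 * z.2 ^ (β j - 1)) ^ (d - i) * a i (g z).1 + u (g z)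
    have hU : AnalyticAt ℝ U 0 := by
      refine (Finset.analyticAt_fun_sum _ fun i _ => ?_).fun_add (hq.analyticAt_comp hu)
      exact (((analyticAt_mon _ analyticAt_fst).mul (analyticAt_snd.pow _)).pow _).mul
        (hq.analyticAt_comp (analyticAt_comp_fst (ha i)))
    refine Res.of_monomial (α := γ) (k := γ j + d) hq.2.2.1 hU ?_ (Eventually.of_forall fun z => ?_)
    · have h0 : g 0 = 0 := hq.2.1
      have : ∀ i ∈ Finset.range d,
          (mon β (0 : (Fin n → ℝ) × ℝ).1 * (0 : (Fin n → ℝ) × ℝ).2 ^ (β j - 1)) ^ (d - i)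
            * a i (g 0).1 = 0 := fun i hi => by
        have := Finset.mem_range.1 hi
        rw [Prod.fst_zero, mon_at_zero hβ, zero_mul, zero_pow (by omega), zero_mul]
      simp only [U]
      rw [Finset.sum_eq_zero this, h0, zero_add]
      exact hu0
    · simp only [weighted, U, mon_update, mul_add, Finset.mul_sum, g]
      congr 1
      · refine Finset.sum_congr rfl fun i hi => ?_
        have hd : z.2 ^ d = z.2 ^ (d - i) * z.2 ^ i := by
          rw [← pow_add, Nat.sub_add_cancel (Finset.mem_range.1 hi).le]
        have hb : z.2 ^ β j = z.2 ^ (β j - 1) * z.2 := by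
          rw [← pow_succ, Nat.sub_add_cancel (Nat.one_le_iff_ne_zero.2 hj)]
        rw [pow_add, hd, hb]
        ring
      · ring

end blowup

end AnalyticGerm

namespace AnalyticGerm

variable {Ω : Type*} {𝒰 : Ultrafilter Ω} {n : ℕ}

theorem not_eventually_zero_prod {E ι : Type*} [NormedAddCommGroup E] [NormedSpace ℝ E]
    {s : Finset ι} {f : ι → E → ℝ}
    (hf : ∀ i ∈ s, AnalyticAt ℝ (f i) 0) (h : ∀ i ∈ s, ¬ ∀ᶠ z in 𝓝 0, f i z = 0) :
    ¬ ∀ᶠ z in 𝓝 0, ∏ i ∈ s, f i z = 0 := by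
  classical
  induction s using Finset.induction_on with
  | empty => intro hc; simpa using hc.self_of_nhds
  | insert i s hi ih =>
    intro hc
    simp only [Finset.prod_insert hi] at hc
    rcases eventually_zero_of_mul (hf i (Finset.mem_insert_self i s))
      (Finset.analyticAt_fun_prod s fun j hj => hf j (Finset.mem_insert_of_mem hj)) hc with h1 | h1
    · exact h i (Finset.mem_insert_self i s) h1
    · exact ih (fun j hj => hf j (Finset.mem_insert_of_mem hj))
        (fun j hj => h j (Finset.mem_insert_of_mem hj)) h1

/-- Simultaneous resolution of finitely many germs. -/
theorem exists_lifts_simultaneous {p : Ω → Fin n → ℝ}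
    (hLU : ∀ f : (Fin n → ℝ) → ℝ, AnalyticAt ℝ f 0 → (¬ ∀ᶠ z in 𝓝 0, f z = 0) → Res 𝒰 n p f)
    {s : Finset ((Fin n → ℝ) → ℝ)} (hs : ∀ f ∈ s, AnalyticAt ℝ f 0) :
    ∃ (g : (Fin n → ℝ) → Fin n → ℝ) (q : Ω → Fin n → ℝ), Lifts 𝒰 p g q ∧
      ∀ f ∈ s, (∀ᶠ z in 𝓝 0, f z = 0) ∨ IsNormal (fun z => f (g z)) := by
  classical
  let t := s.filter fun f => ¬ ∀ᶠ z in 𝓝 0, f z = 0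
  have ht : ∀ f ∈ t, AnalyticAt ℝ f 0 := fun f hf => hs f (Finset.mem_filter.1 hf).1
  obtain ⟨g, q, hg, hn⟩ := hLU (fun z => ∏ f ∈ t, f z) (Finset.analyticAt_fun_prod t ht)
    (not_eventually_zero_prod ht fun f hf => (Finset.mem_filter.1 hf).2)
  refine ⟨g, q, hg, fun f hf => or_iff_not_imp_left.2 fun h => ?_⟩
  exact IsNormal.of_prod (f := fun f z => f (g z)) (fun i hi => hg.analyticAt_comp (ht i hi)) hn
    (Finset.mem_filter.2 ⟨hf, h⟩)

theorem IsNormal.finset_prod {ι : Type*} {s : Finset ι} {f : ι → (Fin n → ℝ) → ℝ}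
    (h : ∀ i ∈ s, IsNormal (f i)) : IsNormal (fun z => ∏ i ∈ s, f i z) := by
  classical
  induction s using Finset.induction_on with
  | empty => simpa using isNormal_of_ne_zero (n := n) analyticAt_const one_ne_zero
  | insert i s hi ih =>
    simp only [Finset.prod_insert hi]
    exact (h i (Finset.mem_insert_self i s)).mul
      (ih fun j hj => h j (Finset.mem_insert_of_mem hj))

theorem res_of_comparable {d : ℕ}
    (hIH : ∀ d' < d, ∀ (γ : Fin n → ℕ) (F : (Fin n → ℝ) × ℝ → ℝ) (p : Ω → (Fin n → ℝ) × ℝ),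
      AnalyticAt ℝ F 0 → RegOrder d' F → Tendsto p 𝒰 (𝓝 0) →
      Res 𝒰 (n + 1) p (fun z => mon γ z.1 * F z))
    {T : Finset ℕ} (hT : T.Nonempty) (hTd : ∀ i ∈ T, i < d) (hTd' : d - 1 ∉ T)
    {β : ℕ → Fin n → ℕ} (hβ : ∀ i ∈ T, β i ≠ 0) (hcomp : ∀ i ∈ T, ∀ j ∈ T, β i ≤ β j ∨ β j ≤ β i)
    {w : ℕ → (Fin n → ℝ) → ℝ} (hw : ∀ i ∈ T, AnalyticAt ℝ (w i) 0) (hw0 : ∀ i ∈ T, w i 0 ≠ 0)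
    {a : ℕ → (Fin n → ℝ) → ℝ}
    (ha : ∀ i ∈ T, ∀ᶠ x in 𝓝 0, a i x = mon (β i) x ^ (d - i) * w i x)
    (ha' : ∀ i < d, i ∉ T → ∀ᶠ x in 𝓝 0, a i x = 0)
    (γ : Fin n → ℕ) {u : (Fin n → ℝ) × ℝ → ℝ} (hu : AnalyticAt ℝ u 0) (hu0 : u 0 ≠ 0)
    {p : Ω → (Fin n → ℝ) × ℝ} (hp : Tendsto p 𝒰 (𝓝 0)) :
    Res 𝒰 (n + 1) p
      (fun z => mon γ z.1 * (∑ i ∈ Finset.range d, a i z.1 * z.2 ^ i + z.2 ^ d * u z)) := by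
  classical
  obtain ⟨b, hb⟩ := Finset.exists_minimal (hT.image β)
  obtain ⟨i₀, hi₀, rfl⟩ := Finset.mem_image.1 hb.prop
  have hmin : ∀ i ∈ T, β i₀ ≤ β i := fun i hi => by
    rcases hcomp i₀ hi₀ i hi with h | h
    · exact h
    · exact hb.le_of_le (Finset.mem_image_of_mem β hi) h
  let A : ℕ → (Fin n → ℝ) → ℝ := fun i =>
    if i ∈ T then fun x => mon (β i - β i₀) x ^ (d - i) * w i x else fun _ => 0
  have hA : ∀ i, AnalyticAt ℝ (A i) 0 := by
    intro i
    by_cases hi : i ∈ T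
    · simp only [A, if_pos hi]
      exact ((analyticAt_mon _ analyticAt_id).pow _).mul (hw i hi)
    · simp only [A, if_neg hi]
      exact analyticAt_const
  have hAi₀ : A i₀ 0 ≠ 0 := by
    simpa [A, hi₀, mon_zero] using hw0 i₀ hi₀
  refine (res_weighted hIH hA (by simp [A, hTd']) (hTd i₀ hi₀) hAi₀ _ (β i₀) γ u p rfl
    (hβ i₀ hi₀) hu hu0 hp).congr ?_
  have hev : ∀ᶠ x in 𝓝 (0 : Fin n → ℝ), ∀ i ∈ Finset.range d,
      a i x = mon (β i₀) x ^ (d - i) * A i x := by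
    refine (Filter.eventually_all_finset _).2 fun i hi => ?_
    by_cases hiT : i ∈ T
    · filter_upwards [ha i hiT] with x hx
      rw [hx, mon_of_le x (hmin i hiT)]
      simp only [A, if_pos hiT]
      ring
    · filter_upwards [ha' i (Finset.mem_range.1 hi) hiT] with x hx
      simp [hx, A, hiT]
  have hfst : Tendsto (fun z : (Fin n → ℝ) × ℝ => z.1) (𝓝 0) (𝓝 0) := continuous_fst.tendsto _
  filter_upwards [hfst.eventually hev] with z hz
  rw [weighted, Finset.sum_congr rfl fun i hi => by rw [hz i hi]]

/-- Resolution of a polynomial without subleading term, given resolution in fewer variables. -/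
theorem res_tschirnhaus {d : ℕ}
    (hLU : ∀ (f : (Fin n → ℝ) → ℝ) (p : Ω → Fin n → ℝ), AnalyticAt ℝ f 0 →
      (¬ ∀ᶠ z in 𝓝 0, f z = 0) → Tendsto p 𝒰 (𝓝 0) → Res 𝒰 n p f)
    (hIH : ∀ d' < d, ∀ (γ : Fin n → ℕ) (F : (Fin n → ℝ) × ℝ → ℝ) (p : Ω → (Fin n → ℝ) × ℝ),
      AnalyticAt ℝ F 0 → RegOrder d' F → Tendsto p 𝒰 (𝓝 0) →
      Res 𝒰 (n + 1) p (fun z => mon γ z.1 * F z))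
    {a : ℕ → (Fin n → ℝ) → ℝ} (ha : ∀ i, AnalyticAt ℝ (a i) 0) (ha0 : ∀ i < d, a i 0 = 0)
    (had : ∀ᶠ x in 𝓝 0, a (d - 1) x = 0)
    (γ : Fin n → ℕ) {u : (Fin n → ℝ) × ℝ → ℝ} (hu : AnalyticAt ℝ u 0) (hu0 : u 0 ≠ 0)
    {p : Ω → (Fin n → ℝ) × ℝ} (hp : Tendsto p 𝒰 (𝓝 0)) :
    Res 𝒰 (n + 1) p
      (fun z => mon γ z.1 * (∑ i ∈ Finset.range d, a i z.1 * z.2 ^ i + z.2 ^ d * u z)) := by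
  classical
  have hp1 : Tendsto (fun w => (p w).1) 𝒰 (𝓝 0) := (continuous_fst.tendsto _).comp hp
  have hfst : Tendsto (fun z : (Fin n → ℝ) × ℝ => z.1) (𝓝 0) (𝓝 0) := continuous_fst.tendsto _
  let T := (Finset.range d).filter fun i => ¬ ∀ᶠ x in 𝓝 0, a i x = 0
  have hTd : ∀ i ∈ T, i < d := fun i hi => Finset.mem_range.1 (Finset.mem_filter.1 hi).1
  have hTa : ∀ i ∈ T, ¬ ∀ᶠ x in 𝓝 0, a i x = 0 := fun i hi => (Finset.mem_filter.1 hi).2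
  have hTn : ∀ i < d, i ∉ T → ∀ᶠ x in 𝓝 0, a i x = 0 := fun i hi hiT => by
    by_contra h
    exact hiT (Finset.mem_filter.2 ⟨Finset.mem_range.2 hi, h⟩)
  rcases T.eq_empty_or_nonempty with hT | hT
  · refine Res.of_monomial (α := γ) (k := d) hp hu hu0 ?_
    have hev : ∀ᶠ x in 𝓝 (0 : Fin n → ℝ), ∀ i ∈ Finset.range d, a i x = 0 :=
      (Filter.eventually_all_finset _).2 fun i hi =>
        hTn i (Finset.mem_range.1 hi) (by simp [hT])
    filter_upwards [hfst.eventually hev] with z hz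
    rw [Finset.sum_eq_zero fun i hi => by rw [hz i hi, zero_mul]]
    ring
  set D := d.factorial with hD
  have hD0 : D ≠ 0 := d.factorial_ne_zero
  let e : ℕ → ℕ := fun i => D / (d - i)
  have he : ∀ i ∈ T, (d - i) * e i = D := fun i hi =>
    Nat.mul_div_cancel' (Nat.dvd_factorial (by have := hTd i hi; omega) (by omega))
  let s : Finset ((Fin n → ℝ) → ℝ) := Finset.univ.image (fun (l : Fin n) x => x l) ∪ (T.image a ∪
    (T ×ˢ T).image fun ij x => a ij.1 x ^ e ij.1 - a ij.2 x ^ e ij.2)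
  have hs : ∀ f ∈ s, AnalyticAt ℝ f 0 := by
    intro f hf
    simp only [s, Finset.mem_union, Finset.mem_image] at hf
    rcases hf with ⟨l, -, rfl⟩ | ⟨i, -, rfl⟩ | ⟨ij, -, rfl⟩
    · exact analyticAt_coord l 0
    · exact ha i
    · exact ((ha _).pow _).sub ((ha _).pow _)
  obtain ⟨g, q, hg, hn⟩ := exists_lifts_simultaneous (fun f hf hf0 => hLU f _ hf hf0 hp1) hs
  have hnγ : IsNormal (fun x => mon γ (g x)) := by
    refine IsNormal.finset_prod (f := fun l x => g x l ^ γ l) fun l _ => ?_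
    refine IsNormal.pow ((hn (fun x => x l) ?_).resolve_left fun h => ?_) _
    · exact Finset.mem_union_left _ (Finset.mem_image_of_mem _ (Finset.mem_univ l))
    · obtain ⟨z, hz, hS⟩ := exists_point_of_eventually h ∅
      exact absurd ((hS l).1 hz) (Set.notMem_empty l)
  obtain ⟨γ', wγ, hwγ, hwγ0, hγ⟩ := hnγ
  have hna : ∀ i, ∃ (α : Fin n → ℕ) (v : (Fin n → ℝ) → ℝ), i ∈ T → AnalyticAt ℝ v 0 ∧ v 0 ≠ 0 ∧
      ∀ᶠ x in 𝓝 0, a i (g x) = mon α x * v x := by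
    intro i
    by_cases hi : i ∈ T
    · obtain ⟨α, v, hv⟩ := (hn (a i) (Finset.mem_union_right _
        (Finset.mem_union_left _ (Finset.mem_image_of_mem _ hi)))).resolve_left (hTa i hi)
      exact ⟨α, v, fun _ => hv⟩
    · exact ⟨0, 0, fun h => absurd h hi⟩
  choose α v hαv using hna
  have hpow : ∀ i ∈ T, ∀ᶠ x in 𝓝 0, a i (g x) ^ e i = mon (e i • α i) x * v i x ^ e i := by
    intro i hi
    filter_upwards [(hαv i hi).2.2] with x hx
    rw [hx, mon_nsmul, mul_pow]
  have hcomp : ∀ i ∈ T, ∀ j ∈ T, e i • α i ≤ e j • α j ∨ e j • α j ≤ e i • α i := by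
    intro i hi j hj
    refine le_or_le_of_sub (u := fun x => v i x ^ e i) (v := fun x => v j x ^ e j)
      ((hαv i hi).1.pow _) (pow_ne_zero _ (hαv i hi).2.1)
      ((hαv j hj).1.pow _) (pow_ne_zero _ (hαv j hj).2.1) ?_
    have hmem : (fun x => a i x ^ e i - a j x ^ e j) ∈ s :=
      Finset.mem_union_right _ (Finset.mem_union_right _
        (Finset.mem_image.2 ⟨(i, j), Finset.mem_product.2 ⟨hi, hj⟩, rfl⟩))
    refine (hn _ hmem).imp (fun h => ?_) (fun h => h.congr ?_)
    · filter_upwards [hg.tendsto.eventually h, hpow i hi, hpow j hj] with x h1 h2 h3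
      rw [h2, h3] at h1
      exact h1
    · filter_upwards [hpow i hi, hpow j hj] with x h2 h3
      rw [h2, h3]
      rfl
  obtain ⟨ε, hε, q', hr⟩ := exists_lifts_ramify hg.2.2.1 hD0
  set r : (Fin n → ℝ) → Fin n → ℝ := fun x i => ε i * x i ^ D with hrdef
  have hmonr : ∀ (δ : Fin n → ℕ) x, mon δ (r x) = mon δ ε * mon (D • δ) x := by
    intro δ x
    rw [← mon_pow, ← mon_mul]
  have hL := Lifts.prodMap hp (hg.comp hr)
  refine Res.of_lifts hL ?_
  have hβ0 : ∀ i ∈ T, e i • α i ≠ 0 := by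
    intro i hi h
    have he0 : e i ≠ 0 := fun h0 => hD0 (by rw [← he i hi, h0, mul_zero])
    have hα0 : α i = 0 := (smul_eq_zero.1 h).resolve_left he0
    have h1 := (hαv i hi).2.2.self_of_nhds
    rw [hg.2.1, ha0 i (hTd i hi), hα0, mon_zero, one_mul] at h1
    exact (hαv i hi).2.1 h1.symm
  have hW : AnalyticAt ℝ (fun z : (Fin n → ℝ) × ℝ => mon γ' ε * wγ (r z.1)) 0 :=
    analyticAt_const.mul (analyticAt_comp_fst (hr.analyticAt_comp hwγ))
  have key := res_of_comparable (𝒰 := 𝒰) (a := fun i x => a i (g (r x)))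
    (w := fun i x => mon (α i) ε * v i (r x)) (β := fun i => e i • α i) hIH hT hTd
    (fun h => hTa _ h had) hβ0 hcomp
    (fun i hi => analyticAt_const.mul (hr.analyticAt_comp (hαv i hi).1))
    (fun i hi => mul_ne_zero (mon_ne_zero hε) (by rw [hr.2.1]; exact (hαv i hi).2.1))
    (fun i hi => by
      filter_upwards [hr.tendsto.eventually (hαv i hi).2.2] with x hx
      rw [hx, hmonr, ← mon_nsmul, ← mul_smul, he i hi]
      ring)
    (fun i hi hiT => (hg.tendsto.comp hr.tendsto).eventually (hTn i hi hiT))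
    (D • γ') (hL.analyticAt_comp hu) ((congrArg u hL.2.1).trans_ne hu0) hL.2.2.1
  refine (key.mul_unit hW ?_).congr ?_
  · refine mul_ne_zero (mon_ne_zero hε) ?_
    rw [Prod.fst_zero, hr.2.1]
    exact hwγ0
  · filter_upwards [(hr.tendsto.comp hfst).eventually hγ] with z hz
    have hz' : mon γ (g (r z.1)) = mon γ' (r z.1) * wγ (r z.1) := hz
    rw [hz', hmonr]
    ring

end AnalyticGerm

namespace AnalyticGerm

theorem taylor_unique {d : ℕ} {c : ℕ → ℝ} : ∀ {w : ℝ → ℝ}, ContinuousAt w 0 →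
    (∀ᶠ y in 𝓝[≠] 0, ∑ i ∈ Finset.range d, c i * y ^ i + y ^ d * w y = 0) →
    (∀ i < d, c i = 0) ∧ w 0 = 0 := by
  induction d with
  | zero =>
    intro w hw h
    refine ⟨by simp, ?_⟩
    refine tendsto_nhds_unique (l := 𝓝[≠] (0 : ℝ)) (hw.tendsto.mono_left nhdsWithin_le_nhds)
      ((tendsto_const_nhds (x := (0 : ℝ))).congr' ?_)
    filter_upwards [h] with y hy
    simpa using hy.symm
  | succ d ih =>
    intro w hw h
    have h1 := ih (w := fun y => c d + y * w y) (by fun_prop) (by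
      filter_upwards [h] with y hy
      rw [Finset.sum_range_succ] at hy
      linear_combination hy)
    have hcd : c d = 0 := by simpa using h1.2
    have hc : ∀ i < d + 1, c i = 0 := fun i hi => by
      rcases Nat.lt_succ_iff_lt_or_eq.1 hi with h | rfl
      · exact h1.1 i h
      · exact hcd
    refine ⟨hc, ?_⟩
    refine tendsto_nhds_unique (l := 𝓝[≠] (0 : ℝ)) (hw.tendsto.mono_left nhdsWithin_le_nhds)
      ((tendsto_const_nhds (x := (0 : ℝ))).congr' ?_)
    filter_upwards [h, self_mem_nhdsWithin] with y hy hy0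
    rw [Finset.sum_eq_zero fun i hi => by rw [hc i (Finset.mem_range.1 hi), zero_mul],
      zero_add] at hy
    exact ((mul_eq_zero.1 hy).resolve_left (pow_ne_zero _ hy0)).symm

theorem iteratedDeriv_eq_of_taylor {d : ℕ} {c : ℕ → ℝ} {f w : ℝ → ℝ} {t : ℝ}
    (hf : AnalyticAt ℝ f t) (hw : AnalyticAt ℝ w 0)
    (h : ∀ᶠ y in 𝓝 0, f (t + y) = ∑ i ∈ Finset.range d, c i * y ^ i + y ^ d * w y) {k : ℕ}
    (hk : k < d) : iteratedDeriv k f t = k.factorial * c k := by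
  have hft : AnalyticAt ℝ (fun y => f (t + y)) 0 :=
    AnalyticAt.fun_comp_of_eq hf (f := fun y => t + y) (by fun_prop) (by simp)
  have hmon : ∀ i, AnalyticAt ℝ (fun y : ℝ => y ^ i) 0 := fun i => by fun_prop
  have hsum : AnalyticAt ℝ (fun y => ∑ i ∈ Finset.range d, c i * y ^ i) 0 :=
    Finset.analyticAt_fun_sum _ fun i _ => analyticAt_const.fun_mul (hmon i)
  have h1 : (d : ℕ∞) ≤ analyticOrderAt
      (fun y => f (t + y) - ∑ i ∈ Finset.range d, c i * y ^ i) 0 := by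
    rw [natCast_le_analyticOrderAt (hft.fun_sub hsum)]
    refine ⟨w, hw, ?_⟩
    filter_upwards [h] with y hy
    rw [hy]; simp
  have h2 := (natCast_le_analyticOrderAt_iff_iteratedDeriv_eq_zero (hft.fun_sub hsum)).1 h1 k hk
  have h3 : iteratedDeriv k (fun y => f (t + y)) 0 =
      iteratedDeriv k (fun y => ∑ i ∈ Finset.range d, c i * y ^ i) 0 := by
    have := iteratedDeriv_fun_sub (n := k) hft.contDiffAt hsum.contDiffAt
    rw [h2] at this
    linarith
  rw [iteratedDeriv_comp_const_add] at h3
  simp only [add_zero] at h3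
  rw [h3, iteratedDeriv_fun_sum fun i _ => (analyticAt_const.fun_mul (hmon i)).contDiffAt]
  rw [Finset.sum_eq_single k]
  · rw [iteratedDeriv_const_mul_field, iteratedDeriv_fun_pow_zero, if_pos rfl, mul_comm]
  · intro i _ hik
    rw [iteratedDeriv_const_mul_field, iteratedDeriv_fun_pow_zero, if_neg (Ne.symm hik),
      Nat.cast_zero, mul_zero]
  · intro hk'
    exact absurd (Finset.mem_range.2 hk) hk'

theorem iteratedDeriv_ne_zero_of_order {d : ℕ} {f v : ℝ → ℝ} (hv : AnalyticAt ℝ v 0)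
    (hv0 : v 0 ≠ 0) (h : ∀ᶠ y in 𝓝 0, f y = y ^ d * v y) : iteratedDeriv d f 0 ≠ 0 := by
  obtain ⟨w, hw, hvw⟩ := hv.exists_eq_add_mul (ContinuousLinearMap.id ℝ ℝ) 1 0 (by simp)
    (fun z => by simp)
  have hf : AnalyticAt ℝ f 0 := by
    have h1 : AnalyticAt ℝ (fun y => y ^ d * v y) 0 := by fun_prop
    exact h1.congr (h.mono fun _ hy => hy.symm)
  rw [iteratedDeriv_eq_of_taylor (d := d + 1) (c := fun i => if i = d then v 0 else 0) hf hw ?_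
    (Nat.lt_succ_self d)]
  · simp [hv0, Nat.factorial_ne_zero]
  · filter_upwards [h, hvw] with y h1 h2
    rw [zero_add, h1, h2]
    simp
    ring

variable {E : Type*} [NormedAddCommGroup E] [NormedSpace ℝ E]

/-- The analytic implicit function theorem for a scalar equation. -/
theorem exists_analytic_implicit [CompleteSpace E] {A : E × ℝ → ℝ} (hA : AnalyticAt ℝ A 0)
    (hA0 : A 0 = 0) {c : ℝ} (hc : c ≠ 0) (hd : HasDerivAt (fun t => A (0, t)) c 0) :
    ∃ b : E → ℝ, AnalyticAt ℝ b 0 ∧ b 0 = 0 ∧ ∀ᶠ x in 𝓝 0, A (x, b x) = 0 := by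
  have hC : ContDiffAt ℝ ⊤ A 0 := hA.contDiffAt
  have hfd : HasDerivAt (fun t => A (0, t)) (fderiv ℝ A 0 (0, 1)) 0 := by
    have h1 : HasFDerivAt A (fderiv ℝ A 0) ((0 : E), (0 : ℝ)) := hA.differentiableAt.hasFDerivAt
    exact h1.comp_hasDerivAt (0 : ℝ) ((hasDerivAt_const (0 : ℝ) (0 : E)).prodMk (hasDerivAt_id 0))
  have hval : fderiv ℝ A 0 (0, 1) = c := hfd.unique hd
  have hinv : (fderiv ℝ A 0 ∘L .inr ℝ E ℝ).IsInvertible := by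
    refine ⟨ContinuousLinearEquiv.unitsEquivAut ℝ (Units.mk0 c hc), ?_⟩
    ext
    simp [hval]
  have hne : (⊤ : WithTop ℕ∞) ≠ 0 := by simp
  refine ⟨hC.implicitFunction hne hinv, ?_, hC.implicitFunction_apply_self hne hinv, ?_⟩
  · have := hC.contDiffAt_implicitFunction hne hinv
    rw [← contDiffWithinAt_univ] at this
    simpa using (contDiffWithinAt_omega_iff_analyticWithinAt.1 this)
  · have := hC.eventually_apply_implicitFunction hne hinv
    rwa [hA0] at this

/-- Tschirnhaus transformation: after an analytic translation of the last variable, the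
subleading coefficient vanishes. -/
theorem exists_tschirnhaus [CompleteSpace E] {d : ℕ} (hd : 1 ≤ d) {F : E × ℝ → ℝ}
    (hF : AnalyticAt ℝ F 0) (hreg : RegOrder d F) :
    ∃ (b : E → ℝ) (a : ℕ → E → ℝ) (u : E × ℝ → ℝ), AnalyticAt ℝ b 0 ∧ b 0 = 0 ∧
      (∀ i, AnalyticAt ℝ (a i) 0) ∧ (∀ i < d, a i 0 = 0) ∧ (∀ᶠ x in 𝓝 0, a (d - 1) x = 0) ∧
      AnalyticAt ℝ u 0 ∧ u 0 ≠ 0 ∧ ∀ᶠ z in 𝓝 0,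
        F (z.1, b z.1 + z.2) = ∑ i ∈ Finset.range d, a i z.1 * z.2 ^ i + z.2 ^ d * u z := by
  obtain ⟨v, hv, hv0, hφ⟩ := hreg
  have hsh : AnalyticAt ℝ (fun z : (E × ℝ) × ℝ => (z.1.1, z.1.2 + z.2)) 0 :=
    (analyticAt_fst.fun_comp analyticAt_fst).prod
      ((analyticAt_snd.fun_comp analyticAt_fst).add analyticAt_snd)
  have hF' : AnalyticAt ℝ (fun z : (E × ℝ) × ℝ => F (z.1.1, z.1.2 + z.2)) 0 :=
    AnalyticAt.fun_comp_of_eq hF hsh (by simp)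
  obtain ⟨A, U, hA, hU, hexp⟩ := exists_taylor_snd hF' d
  have hlift : Tendsto (fun z : ℝ × ℝ => (((0 : E), z.1), z.2)) (𝓝 0) (𝓝 0) := by
    have : Continuous (fun z : ℝ × ℝ => (((0 : E), z.1), z.2)) := by fun_prop
    exact this.tendsto 0
  have hUan : ∀ᶠ t in 𝓝 (0 : ℝ), AnalyticAt ℝ (fun y => U ((0, t), y)) 0 := by
    have hc : Tendsto (fun t : ℝ => (((0 : E), t), (0 : ℝ))) (𝓝 0) (𝓝 0) := by
      have : Continuous (fun t : ℝ => (((0 : E), t), (0 : ℝ))) := by fun_prop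
      exact this.tendsto 0
    filter_upwards [hc.eventually hU.eventually_analyticAt] with t ht
    exact AnalyticAt.fun_comp_of_eq ht (f := fun y => (((0 : E), t), y))
      (analyticAt_const.prod analyticAt_id) rfl
  have hφan : AnalyticAt ℝ (fun t => F ((0 : E), t)) 0 :=
    AnalyticAt.fun_comp_of_eq hF (f := fun t => ((0 : E), t))
      (analyticAt_const.prod analyticAt_id) rfl
  have hexp0 : ∀ᶠ t in 𝓝 (0 : ℝ), ∀ᶠ y in 𝓝 (0 : ℝ), F (0, t + y) =
      ∑ i ∈ Finset.range d, A i (0, t) * y ^ i + y ^ d * U ((0, t), y) := by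
    have := hlift.eventually hexp
    rw [Prod.zero_eq_mk, nhds_prod_eq] at this
    exact this.curry
  have hAder : ∀ᶠ t in 𝓝 (0 : ℝ), A (d - 1) (0, t) =
      ((d - 1).factorial : ℝ)⁻¹ * iteratedDeriv (d - 1) (fun t => F (0, t)) t := by
    filter_upwards [hexp0, hUan, hφan.eventually_analyticAt] with t h1 h2 h3
    rw [iteratedDeriv_eq_of_taylor (f := fun t => F (0, t)) h3 h2 h1 (by omega : d - 1 < d),
      inv_mul_cancel_left₀ (by exact_mod_cast (d - 1).factorial_ne_zero)]
  have hcoef := taylor_unique (d := d) (c := fun i => A i 0) (w := fun y => U (0, y) - v y)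
    (hUan.self_of_nhds.continuousAt.sub hv.continuousAt) (by
      refine eventually_nhdsWithin_of_eventually_nhds ?_
      filter_upwards [hexp0.self_of_nhds, hφ] with y h1 h2
      rw [zero_add, h2] at h1
      have : (0 : E × ℝ) = (0, 0) := rfl
      rw [this]
      linear_combination -h1)
  have hderiv : HasDerivAt (fun t => A (d - 1) (0, t))
      (((d - 1).factorial : ℝ)⁻¹ * iteratedDeriv d (fun t => F (0, t)) 0) 0 := by
    have h1 : DifferentiableAt ℝ (iteratedDeriv (d - 1) (fun t => F ((0 : E), t))) 0 :=
      (iteratedDeriv_eq_iterate (𝕜 := ℝ) (F := ℝ) ▸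
        AnalyticAt.iterated_deriv hφan (d - 1)).differentiableAt
    have h2 := h1.hasDerivAt
    rw [← iteratedDeriv_succ, Nat.sub_add_cancel hd] at h2
    exact (h2.const_mul _).congr_of_eventuallyEq hAder
  obtain ⟨b, hb, hb0, hAb⟩ := exists_analytic_implicit (hA (d - 1)) (hcoef.1 _ (by omega))
    (mul_ne_zero (inv_ne_zero (by exact_mod_cast (d - 1).factorial_ne_zero))
      (iteratedDeriv_ne_zero_of_order hv hv0 hφ)) hderiv
  have hgraph : AnalyticAt ℝ (fun x => (x, b x)) 0 := analyticAt_id.prod hb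
  have hgraph0 : ((0 : E), b 0) = 0 := by rw [hb0]; rfl
  have hgr2 : AnalyticAt ℝ (fun z : E × ℝ => ((z.1, b z.1), z.2)) 0 :=
    (AnalyticAt.fun_comp_of_eq hgraph analyticAt_fst rfl).prod analyticAt_snd
  have hgr20 : (((0 : E × ℝ).1, b (0 : E × ℝ).1), (0 : E × ℝ).2) = 0 := by
    simp [hb0]
  refine ⟨b, fun i x => A i (x, b x), fun z => U ((z.1, b z.1), z.2), hb, hb0, fun i => ?_,
    fun i hi => ?_, hAb, ?_, ?_, ?_⟩
  · exact AnalyticAt.fun_comp_of_eq (hA i) hgraph hgraph0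
  · change A i (0, b 0) = 0
    rw [hgraph0]
    exact hcoef.1 i hi
  · exact AnalyticAt.fun_comp_of_eq hU hgr2 hgr20
  · change U (((0 : E × ℝ).1, b (0 : E × ℝ).1), (0 : E × ℝ).2) ≠ 0
    rw [hgr20]
    have : U 0 - v 0 = 0 := hcoef.2
    rw [sub_eq_zero.1 this]
    exact hv0
  · have := hgr2.continuousAt.tendsto
    rw [hgr20] at this
    exact this.eventually hexp

end AnalyticGerm

namespace AnalyticGerm

section shear

variable {E : Type*} [NormedAddCommGroup E] [NormedSpace ℝ E]

/-- A nonzero germ becomes regular in the last variable after a shear. -/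
theorem exists_regOrder_shear {F : E × ℝ → ℝ} (hF : AnalyticAt ℝ F 0)
    (h0 : ¬ ∀ᶠ z in 𝓝 0, F z = 0) :
    ∃ (c : E) (d : ℕ), RegOrder d (fun z => F (z.1 + z.2 • c, z.2)) := by
  obtain ⟨r, hr, hball⟩ := Metric.eventually_nhds_iff_ball.1 hF.eventually_analyticAt
  have hex : ∃ z ∈ Metric.ball (0 : E × ℝ) r, F z ≠ 0 := by
    by_contra! hc
    exact h0 (Metric.eventually_nhds_iff_ball.2 ⟨r, hr, hc⟩)
  obtain ⟨z, hz, hFz⟩ := hex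
  have hT : Tendsto (fun t : ℝ => (z.1, z.2 + t)) (𝓝[≠] 0) (𝓝 z) := by
    have : Continuous (fun t : ℝ => (z.1, z.2 + t)) := by fun_prop
    have h1 := this.tendsto 0
    simp only [add_zero] at h1
    exact h1.mono_left nhdsWithin_le_nhds
  have hne : ∀ᶠ t in 𝓝[≠] (0 : ℝ), z.2 + t ≠ 0 := by
    rcases eq_or_ne z.2 0 with h | h
    · filter_upwards [self_mem_nhdsWithin] with t ht
      simpa [h] using ht
    · have h1 : ContinuousAt (fun t : ℝ => z.2 + t) 0 := by fun_prop
      exact (h1.eventually_ne (by simpa using h)).filter_mono nhdsWithin_le_nhds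
  obtain ⟨t, ⟨ht1, ht2⟩, ht3⟩ := ((hT.eventually ((Metric.isOpen_ball.mem_nhds hz))).and
    (hT.eventually ((hball z hz).continuousAt.eventually_ne hFz)) |>.and hne).exists
  set s := z.2 + t
  let w : E × ℝ := (s⁻¹ • z.1, 1)
  have hw : s • w = (z.1, s) := by
    simp [w, smul_smul, mul_inv_cancel₀ ht3]
  have hlin : ∀ y : ℝ, AnalyticAt ℝ (fun y : ℝ => y • w) y := fun y =>
    ((ContinuousLinearMap.id ℝ ℝ).smulRight w).analyticAt y
  have han : AnalyticOnNhd ℝ (fun y : ℝ => F (y • w))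
      ((LinearMap.toSpanSingleton ℝ (E × ℝ) w) ⁻¹' Metric.ball 0 r) := fun y hy =>
    AnalyticAt.fun_comp_of_eq (hball _ hy) (hlin y) rfl
  have h0mem : (0 : ℝ) ∈ (LinearMap.toSpanSingleton ℝ (E × ℝ) w) ⁻¹' Metric.ball 0 r := by
    simpa using hr
  have hnz : ¬ ∀ᶠ y in 𝓝 (0 : ℝ), F (y • w) = 0 := by
    intro hc
    have := han.eqOn_zero_of_preconnected_of_eventuallyEq_zero
      ((convex_ball 0 r).linear_preimage _).isPreconnected h0mem hc (x := s) (by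
        change s • w ∈ Metric.ball (0 : E × ℝ) r
        rwa [hw])
    simp only [hw] at this
    exact ht2 this
  obtain ⟨d, v, hv, hv0, hvd⟩ := (han 0 h0mem).exists_eventuallyEq_pow_smul_nonzero_iff.2 hnz
  refine ⟨s⁻¹ • z.1, d, v, hv, hv0, ?_⟩
  filter_upwards [hvd] with y hy
  simpa [w] using hy

end shear

variable {Ω : Type*} {𝒰 : Ultrafilter Ω} {n : ℕ}

theorem res_regular
    (hLU : ∀ (f : (Fin n → ℝ) → ℝ) (p : Ω → Fin n → ℝ), AnalyticAt ℝ f 0 →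
      (¬ ∀ᶠ z in 𝓝 0, f z = 0) → Tendsto p 𝒰 (𝓝 0) → Res 𝒰 n p f) (d : ℕ) :
    ∀ (γ : Fin n → ℕ) (F : (Fin n → ℝ) × ℝ → ℝ) (p : Ω → (Fin n → ℝ) × ℝ),
      AnalyticAt ℝ F 0 → RegOrder d F → Tendsto p 𝒰 (𝓝 0) →
      Res 𝒰 (n + 1) p (fun z => mon γ z.1 * F z) := by
  induction d using Nat.strong_induction_on with
  | _ d ih =>
    intro γ F p hF hreg hp
    rcases Nat.eq_zero_or_pos d with rfl | hd
    · obtain ⟨v, hv, hv0, h⟩ := hreg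
      have h0 := h.self_of_nhds
      simp only [pow_zero, one_mul] at h0
      refine Res.of_monomial (k := 0) hp hF ?_ (Eventually.of_forall fun z => by ring)
      rw [Prod.zero_eq_mk, h0]
      exact hv0
    · obtain ⟨b, a, u, hb, hb0, ha, ha0, had, hu, hu0, hexp⟩ := exists_tschirnhaus hd hF hreg
      have hp1 : Tendsto (fun w => (p w).1) 𝒰 (𝓝 0) := (continuous_fst.tendsto _).comp hp
      have hp2 : Tendsto (fun w => (p w).2) 𝒰 (𝓝 0) := (continuous_snd.tendsto _).comp hp
      have hbp : Tendsto (fun w => b (p w).1) 𝒰 (𝓝 0) := by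
        have := hb.continuousAt.tendsto.comp hp1
        rwa [hb0] at this
      have hl : Lifts 𝒰 p (fun z : (Fin n → ℝ) × ℝ => (z.1, b z.1 + z.2))
          (fun w => ((p w).1, (p w).2 - b (p w).1)) := by
        refine ⟨analyticAt_fst.prod ((analyticAt_comp_fst hb).add analyticAt_snd), by simp [hb0],
          ?_, Eventually.of_forall fun w => by simp⟩
        simpa [← Prod.zero_eq_mk] using hp1.prodMk_nhds (hp2.sub hbp)
      refine Res.of_lifts hl ((res_tschirnhaus hLU ih ha ha0 had γ hu hu0 hl.2.2.1).congr ?_)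
      filter_upwards [hexp] with z hz
      rw [hz]

/-- Local uniformization along an ultrafilter: every nonzero analytic germ becomes a monomial
times a unit after an analytic change of variables through which the ultrafilter lifts. -/
theorem local_uniformization (n : ℕ) : ∀ (f : (Fin n → ℝ) → ℝ) (p : Ω → Fin n → ℝ),
    AnalyticAt ℝ f 0 → (¬ ∀ᶠ z in 𝓝 0, f z = 0) → Tendsto p 𝒰 (𝓝 0) → Res 𝒰 n p f := by
  induction n with
  | zero =>
    intro f p hf h0 hp
    refine ⟨fun z => z, p, ⟨analyticAt_id, rfl, hp, by simp⟩, isNormal_of_ne_zero hf fun hc => ?_⟩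
    exact h0 (Eventually.of_forall fun z => by rw [Subsingleton.elim z 0, hc])
  | succ n ih =>
    intro f p hf h0 hp
    have hl := Lifts.of_equiv hp (snocEquiv n)
    refine Res.of_lifts hl ?_
    set F : (Fin n → ℝ) × ℝ → ℝ := fun z => f (snocEquiv n z) with hFdef
    have hF : AnalyticAt ℝ F 0 := hl.analyticAt_comp hf
    have hF0 : ¬ ∀ᶠ z in 𝓝 0, F z = 0 := by
      intro hc
      refine h0 ?_
      have := ((snocEquiv n).symm.continuous.tendsto 0).eventually (by rwa [map_zero])
      filter_upwards [this] with z hz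
      simpa [hFdef] using hz
    obtain ⟨c, d, hreg⟩ := exists_regOrder_shear hF hF0
    set q := fun w => (snocEquiv n).symm (p w)
    have hq : Tendsto q 𝒰 (𝓝 0) := hl.2.2.1
    have hq1 : Tendsto (fun w => (q w).1) 𝒰 (𝓝 0) := (continuous_fst.tendsto _).comp hq
    have hq2 : Tendsto (fun w => (q w).2) 𝒰 (𝓝 0) := (continuous_snd.tendsto _).comp hq
    have hl2 : Lifts 𝒰 q (fun z : (Fin n → ℝ) × ℝ => (z.1 + z.2 • c, z.2))
        (fun w => ((q w).1 - (q w).2 • c, (q w).2)) := by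
      refine ⟨(analyticAt_fst.add (analyticAt_snd.smul analyticAt_const)).prod analyticAt_snd,
        by simp, ?_, Eventually.of_forall fun w => by simp⟩
      simpa [← Prod.zero_eq_mk] using (hq1.sub (hq2.smul_const c)).prodMk_nhds hq2
    refine Res.of_lifts hl2 ((res_regular ih d 0 _ _ (hl2.analyticAt_comp hF) hreg
      hl2.2.2.1).congr (Eventually.of_forall fun z => ?_))
    simp [mon_zero]

end AnalyticGerm

namespace AnalyticGerm

variable {n : ℕ}

theorem mon_scale_coord (α : Fin n → ℕ) (z : Fin n → ℝ) (j : Fin n) (t : ℝ) :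
    mon α (z + t • Pi.single j (z j)) = (1 + t) ^ α j * mon α z := by
  classical
  simp only [mon]
  rw [← Finset.mul_prod_erase Finset.univ _ (Finset.mem_univ j),
    ← Finset.mul_prod_erase Finset.univ (fun i => z i ^ α i) (Finset.mem_univ j), ← mul_assoc,
    ← mul_pow]
  congr 1
  · simp; ring
  · refine Finset.prod_congr rfl fun i hi => ?_
    simp [(Finset.mem_erase.1 hi).1]

/-- The Łojasiewicz gradient inequality for a monomial times a unit. -/
theorem IsNormal.lojasiewicz {h : (Fin n → ℝ) → ℝ} (hn : IsNormal h) (h0 : h 0 = 0) :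
    ∃ (m : ℕ) (C : ℝ), 0 ≤ C ∧ ∀ᶠ z in 𝓝 0, |h z| ^ m ≤ (C * ‖fderiv ℝ h z‖) ^ (m + 1) := by
  obtain ⟨α, u, hu, hu0, hh⟩ := hn
  have hα : ∃ j, α j ≠ 0 := by
    by_contra! hc
    have := hh.self_of_nhds
    exact hu0 (by simpa [hc, h0] using this.symm)
  have hm : ∑ i, α i ≠ 0 := by
    obtain ⟨j, hj⟩ := hα
    exact fun hc => hj (Finset.sum_eq_zero_iff.1 hc j (Finset.mem_univ j))
  set m := ∑ i, α i
  have hua : 0 < |u 0| := abs_pos.2 hu0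
  set c := |u 0| / 2 with hc
  have hcpos : 0 < c := by positivity
  refine ⟨m, 2 * max 1 c⁻¹, by positivity, ?_⟩
  have hu1 : ∀ᶠ z in 𝓝 0, c < |u z| :=
    hu.continuousAt.abs.eventually (lt_mem_nhds (by linarith : c < |u 0|))
  have hz1 : ∀ᶠ z : Fin n → ℝ in 𝓝 0, ‖z‖ < 1 :=
    continuous_norm.continuousAt.eventually (gt_mem_nhds (by simp))
  have hdu : ∀ᶠ z in 𝓝 0, ‖fderiv ℝ u z‖ * ‖z‖ < c / 2 := by
    have h1 : ContinuousAt (fun z => ‖fderiv ℝ u z‖ * ‖z‖) 0 :=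
      hu.fderiv.continuousAt.norm.mul continuous_norm.continuousAt
    exact h1.eventually (gt_mem_nhds (by simpa using by positivity))
  filter_upwards [hu1, hz1, hdu, hh.eventually_nhds, hu.eventually_analyticAt] with z h1 h2 h3 h4 h5
  rcases eq_or_ne (h z) 0 with hz | hz
  · rw [hz, abs_zero, zero_pow hm]
    positivity
  obtain ⟨j, hj, hjmin⟩ := Finset.exists_min_image (Finset.univ.filter fun i => α i ≠ 0)
    (fun i => |z i|) (by
      obtain ⟨j, hj⟩ := hα
      exact ⟨j, by simpa using hj⟩)
  simp only [Finset.mem_filter, Finset.mem_univ, true_and] at hj hjmin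
  have hzj : |z j| ≤ ‖z‖ := by simpa using norm_le_pi_norm z j
  have hval : h z = mon α z * u z := h4.self_of_nhds
  have hP : |z j| ^ (m + 1) ≤ |mon α z| := by
    calc |z j| ^ (m + 1) ≤ |z j| ^ m :=
          pow_le_pow_of_le_one (abs_nonneg _) (by linarith) (Nat.le_succ m)
      _ = ∏ i, |z j| ^ α i := (Finset.prod_pow_eq_pow_sum _ _ _).symm
      _ ≤ ∏ i, |z i| ^ α i := by
          refine Finset.prod_le_prod (fun i _ => by positivity) fun i _ => ?_
          rcases eq_or_ne (α i) 0 with h | h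
          · simp [h]
          · exact pow_le_pow_left₀ (abs_nonneg _) (hjmin i h) _
      _ = |mon α z| := by simp [mon, Finset.abs_prod, abs_pow]
  set w : Fin n → ℝ := Pi.single j (z j)
  have hw : ‖w‖ = |z j| := by rw [Pi.norm_single, Real.norm_eq_abs]
  have hmonan : AnalyticAt ℝ (fun z : Fin n → ℝ => mon α z) z := analyticAt_monomial α z
  have hhd : DifferentiableAt ℝ h z :=
    ((hmonan.fun_mul h5).congr (h4.mono fun _ h => h.symm)).differentiableAt
  have hline : HasDerivAt (fun t : ℝ => z + t • w) w 0 := by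
    simpa using ((hasDerivAt_id (0 : ℝ)).smul_const w).const_add z
  have hz0 : z + (0 : ℝ) • w = z := by simp
  have hd1 : HasDerivAt (fun t : ℝ => h (z + t • w)) (fderiv ℝ h z w) 0 := by
    refine HasFDerivAt.comp_hasDerivAt (0 : ℝ) ?_ hline
    rw [hz0]; exact hhd.hasFDerivAt
  have hd2 : HasDerivAt (fun t : ℝ => u (z + t • w)) (fderiv ℝ u z w) 0 := by
    refine HasFDerivAt.comp_hasDerivAt (0 : ℝ) ?_ hline
    rw [hz0]; exact h5.differentiableAt.hasFDerivAt
  have hd3 : HasDerivAt (fun t : ℝ => (1 + t) ^ α j * mon α z * u (z + t • w))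
      (α j * mon α z * u z + mon α z * fderiv ℝ u z w) 0 := by
    have := ((((hasDerivAt_id (0 : ℝ)).const_add 1).pow (α j)).mul_const (mon α z)).mul hd2
    simp only [id, add_zero, one_pow, mul_one, zero_smul] at this
    simpa [Pi.mul_def, Pi.pow_def] using this
  have heq : fderiv ℝ h z w = α j * mon α z * u z + mon α z * fderiv ℝ u z w := by
    refine hd1.unique (hd3.congr_of_eventuallyEq ?_)
    have ht : Tendsto (fun t : ℝ => z + t • w) (𝓝 0) (𝓝 z) := by
      have := hline.continuousAt.tendsto
      rwa [hz0] at this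
    filter_upwards [ht.eventually h4] with t ht
    rw [ht, ← mon_scale_coord]
    rfl
  have hduw : |fderiv ℝ u z w| ≤ c / 2 := by
    refine ((fderiv ℝ u z).le_opNorm w).trans ?_
    rw [hw]
    exact (mul_le_mul_of_nonneg_left hzj (norm_nonneg _)).trans h3.le
  have hmonpos : 0 < |mon α z| := by
    refine abs_pos.2 fun hc => hz ?_
    rw [hval, hc, zero_mul]
  have hlow : |h z| ≤ 2 * (‖fderiv ℝ h z‖ * |z j|) := by
    have ha : |fderiv ℝ h z w| ≤ ‖fderiv ℝ h z‖ * |z j| := by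
      rw [← hw]; exact (fderiv ℝ h z).le_opNorm w
    have hb : α j * h z = fderiv ℝ h z w - mon α z * fderiv ℝ u z w := by
      rw [heq, hval]; ring
    have hαj : (1 : ℝ) ≤ α j := by exact_mod_cast Nat.one_le_iff_ne_zero.2 hj
    have hc1 : |h z| ≤ |α j * h z| := by
      rw [abs_mul, Nat.abs_cast]
      exact le_mul_of_one_le_left (abs_nonneg _) hαj
    have hc2 : |mon α z * fderiv ℝ u z w| ≤ |h z| / 2 := by
      rw [hval, abs_mul, abs_mul, mul_div_assoc]
      exact mul_le_mul_of_nonneg_left (by linarith) (abs_nonneg _)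
    have hc3 := abs_sub (fderiv ℝ h z w) (mon α z * fderiv ℝ u z w)
    rw [hb] at hc1
    linarith
  have hzh : |z j| ^ (m + 1) ≤ c⁻¹ * |h z| := by
    rw [hval, abs_mul, ← div_eq_inv_mul, le_div_iff₀ hcpos]
    exact mul_le_mul hP h1.le hcpos.le (abs_nonneg _)
  have hmul : |h z| * |h z| ^ m ≤ |h z| * (2 * max 1 c⁻¹ * ‖fderiv ℝ h z‖) ^ (m + 1) := by
    calc |h z| * |h z| ^ m = |h z| ^ (m + 1) := (pow_succ' _ _).symm
      _ ≤ (2 * (‖fderiv ℝ h z‖ * |z j|)) ^ (m + 1) := pow_le_pow_left₀ (abs_nonneg _) hlow _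
      _ = (2 * ‖fderiv ℝ h z‖) ^ (m + 1) * |z j| ^ (m + 1) := by rw [← mul_pow]; ring
      _ ≤ (2 * ‖fderiv ℝ h z‖) ^ (m + 1) * (max 1 c⁻¹ ^ (m + 1) * |h z|) := by
          refine mul_le_mul_of_nonneg_left (hzh.trans ?_) (by positivity)
          refine mul_le_mul_of_nonneg_right ?_ (abs_nonneg _)
          exact (le_max_right _ _).trans (le_self_pow₀ (le_max_left _ _) (by simp))
      _ = |h z| * (2 * max 1 c⁻¹ * ‖fderiv ℝ h z‖) ^ (m + 1) := by
          rw [show 2 * max 1 c⁻¹ * ‖fderiv ℝ h z‖ = 2 * ‖fderiv ℝ h z‖ * max 1 c⁻¹ by ring,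
            mul_pow _ (max 1 c⁻¹)]
          ring
  exact le_of_mul_le_mul_left hmul (abs_pos.2 hz)

/-- The Łojasiewicz gradient inequality at the origin of `ℝⁿ`. -/
theorem lojasiewicz_zero {f : (Fin n → ℝ) → ℝ} (hf : AnalyticAt ℝ f 0) (h0 : f 0 = 0) :
    ∃ (m : ℕ) (C : ℝ), 0 ≤ C ∧ ∀ᶠ z in 𝓝 0, |f z| ^ m ≤ (C * ‖fderiv ℝ f z‖) ^ (m + 1) := by
  by_cases hfz : ∀ᶠ z in 𝓝 0, f z = 0
  · refine ⟨1, 0, le_rfl, hfz.mono fun z hz => by simp [hz]⟩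
  by_contra! hcon
  have hex : ∀ k : ℕ, ∃ x : Fin n → ℝ, ‖x‖ < 1 / (k + 1 : ℝ) ∧ |f x| ≤ 1 ∧
      (k * ‖fderiv ℝ f x‖) ^ (k + 1) < |f x| ^ k := by
    intro k
    have h1 : ∀ᶠ x : Fin n → ℝ in 𝓝 0, ‖x‖ < 1 / (k + 1 : ℝ) :=
      continuous_norm.continuousAt.eventually (gt_mem_nhds (by simp only [norm_zero]; positivity))
    have h2 : ∀ᶠ x in 𝓝 0, |f x| < 1 :=
      hf.continuousAt.abs.eventually (gt_mem_nhds (by simp [h0]))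
    obtain ⟨x, hx, hx1, hx2⟩ := ((hcon k k k.cast_nonneg).and_eventually (h1.and h2)).exists
    exact ⟨x, hx1, hx2.le, hx⟩
  choose x hx1 hx2 hx3 using hex
  have hxt : Tendsto x atTop (𝓝 0) := squeeze_zero_norm (fun k => (hx1 k).le)
    tendsto_one_div_add_atTop_nhds_zero_nat
  obtain ⟨g, q, hg, hn⟩ := local_uniformization (𝒰 := hyperfilter ℕ) n f x hf hfz
    (hxt.mono_left Nat.hyperfilter_le_atTop)
  obtain ⟨m, C, hC, hloj⟩ := hn.lojasiewicz (by rw [hg.2.1, h0])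
  set K := ‖fderiv ℝ g 0‖ + 1
  have hK : ∀ᶠ z in 𝓝 0, ‖fderiv ℝ g z‖ < K :=
    hg.1.fderiv.continuousAt.norm.eventually (gt_mem_nhds (by simp [K]))
  have hchain : ∀ᶠ z in 𝓝 0, ‖fderiv ℝ (fun z => f (g z)) z‖ ≤ ‖fderiv ℝ f (g z)‖ * K := by
    filter_upwards [hK, hg.tendsto.eventually hf.eventually_analyticAt,
      hg.1.eventually_analyticAt] with z h1 h2 h3
    rw [fderiv_fun_comp z h2.differentiableAt h3.differentiableAt]
    exact (ContinuousLinearMap.opNorm_comp_le _ _).trans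
      (mul_le_mul_of_nonneg_left h1.le (norm_nonneg _))
  have hlarge : ∀ᶠ k : ℕ in hyperfilter ℕ, max (m + 1 : ℝ) (C * K) ≤ k :=
    Nat.hyperfilter_le_atTop ((tendsto_natCast_atTop_atTop (R := ℝ)).eventually_ge_atTop _)
  obtain ⟨k, hk1, hk2, hk3, hk4⟩ := (hlarge.and (hg.2.2.2.and ((hg.2.2.1.eventually hloj).and
    (hg.2.2.1.eventually hchain)))).exists
  rw [hk2] at hk3 hk4
  have hmk : m + 1 ≤ k := by exact_mod_cast (le_max_left _ _).trans hk1
  have hkC : C * K ≤ k := (le_max_right _ _).trans hk1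
  set D := ‖fderiv ℝ f (x k)‖
  have hD : 0 ≤ D := norm_nonneg _
  have hlow : |f (x k)| ^ m ≤ (k * D) ^ (m + 1) := by
    refine hk3.trans (pow_le_pow_left₀ (by positivity) ?_ _)
    calc C * ‖fderiv ℝ (fun z => f (g z)) (q k)‖ ≤ C * (D * K) :=
          mul_le_mul_of_nonneg_left hk4 hC
      _ = C * K * D := by ring
      _ ≤ k * D := mul_le_mul_of_nonneg_right hkC hD
  have hA : |f (x k)| ^ (m * (k + 1)) ≤ (k * D) ^ ((m + 1) * (k + 1)) := by
    rw [pow_mul, pow_mul]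
    exact pow_le_pow_left₀ (by positivity) hlow _
  have hB : (k * D) ^ ((m + 1) * (k + 1)) < |f (x k)| ^ (k * (m + 1)) := by
    rw [mul_comm (m + 1), pow_mul, pow_mul]
    exact pow_lt_pow_left₀ (hx3 k) (by positivity) (Nat.succ_ne_zero m)
  have hCc : |f (x k)| ^ (k * (m + 1)) ≤ |f (x k)| ^ (m * (k + 1)) :=
    pow_le_pow_of_le_one (abs_nonneg _) (hx2 k) (by nlinarith)
  exact absurd (hA.trans_lt hB) (not_lt.2 hCc)

/-- The Łojasiewicz gradient inequality. -/
theorem lojasiewicz {E : Type*} [NormedAddCommGroup E] [NormedSpace ℝ E] [FiniteDimensional ℝ E]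
    {f : E → ℝ} {a : E} (hf : AnalyticAt ℝ f a) :
    ∃ (m : ℕ) (C : ℝ), 0 < C ∧
      ∀ᶠ x in 𝓝 a, |f x - f a| ^ m ≤ (C * ‖fderiv ℝ f x‖) ^ (m + 1) := by
  let e : (Fin (Module.finrank ℝ E) → ℝ) ≃L[ℝ] E :=
    (ContinuousLinearEquiv.ofFinrankEq (by simp))
  have hlin : ∀ z, HasFDerivAt (fun z => a + e z) e.toContinuousLinearMap z := fun z =>
    e.hasFDerivAt.const_add a
  have hfe : AnalyticAt ℝ (fun z => f (a + e z) - f a) 0 := by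
    refine AnalyticAt.fun_sub ?_ analyticAt_const
    exact AnalyticAt.fun_comp_of_eq hf
      (analyticAt_const.fun_add (e.toContinuousLinearMap.analyticAt 0)) (by simp)
  obtain ⟨m, C, hC, h⟩ := lojasiewicz_zero hfe (by simp)
  have hback : Tendsto (fun x => e.symm (x - a)) (𝓝 a) (𝓝 0) := by
    have : Continuous (fun x => e.symm (x - a)) := by fun_prop
    simpa using this.tendsto a
  refine ⟨m, C * ‖e.toContinuousLinearMap‖ + 1, by positivity, ?_⟩
  filter_upwards [hback.eventually h, hf.eventually_analyticAt] with x hx hxa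
  simp only [ContinuousLinearEquiv.apply_symm_apply, add_sub_cancel] at hx
  refine hx.trans (pow_le_pow_left₀ (by positivity) ?_ _)
  have hd : HasFDerivAt (fun z => f (a + e z) - f a) ((fderiv ℝ f x).comp e.toContinuousLinearMap)
      (e.symm (x - a)) := by
    refine HasFDerivAt.sub_const _ (HasFDerivAt.comp _ ?_ (hlin _))
    simpa using hxa.differentiableAt.hasFDerivAt
  rw [hd.fderiv]
  have := ContinuousLinearMap.opNorm_comp_le (fderiv ℝ f x) e.toContinuousLinearMap
  calc C * ‖(fderiv ℝ f x).comp e.toContinuousLinearMap‖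
      ≤ C * (‖fderiv ℝ f x‖ * ‖e.toContinuousLinearMap‖) := mul_le_mul_of_nonneg_left this hC
    _ ≤ (C * ‖e.toContinuousLinearMap‖ + 1) * ‖fderiv ℝ f x‖ := by
        nlinarith [norm_nonneg (fderiv ℝ f x)]

end AnalyticGerm

namespace GradientFlow

variable {F : Type*} [NormedAddCommGroup F] [InnerProductSpace ℝ F] [CompleteSpace F]

/-- The inverse of the Riesz isomorphism of a real Hilbert space, as a linear map. -/
noncomputable def riesz (F : Type*) [NormedAddCommGroup F] [InnerProductSpace ℝ F]
    [CompleteSpace F] : StrongDual ℝ F →L[ℝ] F where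
  toFun := (InnerProductSpace.toDual ℝ F).symm
  map_add' := by simp
  map_smul' := by simp
  cont := (InnerProductSpace.toDual ℝ F).symm.continuous

theorem analyticAt_gradient {f : F → ℝ} {x : F} (hf : AnalyticAt ℝ f x) :
    AnalyticAt ℝ (gradient f) x :=
  ((riesz F).analyticAt _).comp hf.fderiv

theorem norm_gradient (f : F → ℝ) (x : F) : ‖gradient f x‖ = ‖fderiv ℝ f x‖ :=
  (InnerProductSpace.toDual ℝ F).symm.norm_map _

/-- Forward trajectories of the gradient flow of `f` in `X`. -/
def IsTrajectory (f : F → ℝ) (X : Set F) (φ : ℝ → F) : Prop :=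
  ∀ t ∈ Ici (0 : ℝ), φ t ∈ X ∧ HasDerivWithinAt φ (-(gradient f (φ t))) (Ici 0) t

variable {f : F → ℝ} {X : Set F} {φ : ℝ → F}

theorem IsTrajectory.hasDerivWithinAt (hφ : IsTrajectory f X φ) {s t : ℝ} (hs : 0 ≤ s)
    (hst : s ≤ t) : HasDerivWithinAt φ (-(gradient f (φ t))) (Ici s) t :=
  (hφ t (hs.trans hst)).2.mono (Ici_subset_Ici.2 hs)

theorem IsTrajectory.energy (hφ : IsTrajectory f X φ) (hf : AnalyticOnNhd ℝ f X) {s t : ℝ}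
    (hs : 0 ≤ s) (hst : s ≤ t) :
    HasDerivWithinAt (fun t => f (φ t)) (-‖gradient f (φ t)‖ ^ 2) (Ici s) t := by
  have hd := (hf _ (hφ t (hs.trans hst)).1).differentiableAt
  have h1 := hd.hasFDerivAt.comp_hasDerivWithinAt t (hφ.hasDerivWithinAt hs hst)
  have h2 : fderiv ℝ f (φ t) (-gradient f (φ t)) = -‖gradient f (φ t)‖ ^ 2 := by
    rw [map_neg, ← InnerProductSpace.toDual_symm_apply (𝕜 := ℝ), ← real_inner_self_eq_norm_sq]
    rfl
  rw [h2] at h1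
  exact h1

theorem IsTrajectory.antitoneOn_energy (hφ : IsTrajectory f X φ) (hf : AnalyticOnNhd ℝ f X) :
    AntitoneOn (fun t => f (φ t)) (Ici 0) := by
  refine antitoneOn_of_hasDerivWithinAt_nonpos (convex_Ici 0)
    (f' := fun t => -‖gradient f (φ t)‖ ^ 2)
    (fun t ht => (hφ.energy hf le_rfl ht).continuousWithinAt) (fun t ht => ?_)
    fun t _ => neg_nonpos.2 (sq_nonneg _)
  exact (hφ.energy hf le_rfl (interior_subset ht)).mono interior_subset

theorem IsTrajectory.tendsto_of_energy_eq (hφ : IsTrajectory f X φ) (hf : AnalyticOnNhd ℝ f X)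
    {a : F} (ha : MapClusterPt a atTop φ) {t₀ : ℝ} (ht₀ : 0 ≤ t₀)
    (h : ∀ t, t₀ ≤ t → f (φ t) = f a) : Tendsto φ atTop (𝓝 a) := by
  have hzero : ∀ t ∈ Ici t₀, gradient f (φ t) = 0 := by
    intro t ht
    have h1 := hφ.energy hf ht₀ ht
    have h2 : HasDerivWithinAt (fun t => f (φ t)) 0 (Ici t₀) t :=
      (hasDerivWithinAt_const t (Ici t₀) (f a)).congr (fun s hs => h s hs) (h t ht)
    have := (uniqueDiffOn_Ici t₀ t ht).eq_deriv _ h1 h2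
    simpa using this
  have hconst : ∀ t ∈ Ici t₀, φ t = φ t₀ := by
    intro t ht
    have := Convex.norm_image_sub_le_of_norm_hasDerivWithin_le (f := φ) (C := 0) (s := Ici t₀)
      (fun s hs => hφ.hasDerivWithinAt ht₀ hs) (fun s hs => by rw [hzero s hs]; simp)
      (convex_Ici t₀) self_mem_Ici ht
    rw [zero_mul] at this
    exact sub_eq_zero.1 (norm_le_zero_iff.1 this)
  have hlim : Tendsto φ atTop (𝓝 (φ t₀)) :=
    tendsto_const_nhds.congr' ((eventually_ge_atTop t₀).mono fun t ht => (hconst t ht).symm)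
  have hae : a = φ t₀ := by
    by_contra hne
    have hf1 := ha.frequently (isOpen_ne.mem_nhds hne : ∀ᶠ y in 𝓝 a, y ≠ φ t₀)
    exact hf1 ((eventually_ge_atTop t₀).mono fun t ht => not_not.2 (hconst t ht))
  rwa [hae]

theorem IsTrajectory.tendsto_of_energy_gt [FiniteDimensional ℝ F] (hφ : IsTrajectory f X φ)
    (hf : AnalyticOnNhd ℝ f X) {a : F} (haX : a ∈ X) (ha : MapClusterPt a atTop φ)
    (hgt : ∀ t, 0 ≤ t → f a < f (φ t)) : Tendsto φ atTop (𝓝 a) := by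
  obtain ⟨m, C, hC, hloj⟩ := AnalyticGerm.lojasiewicz (hf a haX)
  obtain ⟨r, hr, hball⟩ := Metric.eventually_nhds_iff_ball.1 hloj
  set θ : ℝ := ((m + 1 : ℕ) : ℝ)⁻¹ with hθ
  have hθ0 : 0 < θ := by positivity
  set c : ℝ := 2 * C / θ with hc
  have hc0 : 0 < c := by positivity
  rw [Metric.tendsto_atTop]
  intro ε hε
  set ρ := min ε r / 2 with hρ
  have hρ0 : 0 < ρ := by have := lt_min hε hr; positivity
  have hev : ∀ᶠ x in 𝓝 a, ‖x - a‖ < ρ ∧ c * (f x - f a) ^ θ < ρ := by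
    refine Filter.Eventually.and ?_ ?_
    · have : Continuous (fun x => ‖x - a‖) := by fun_prop
      exact this.continuousAt.eventually (gt_mem_nhds (by simpa using hρ0))
    · have h1 : ContinuousAt (fun x => c * (f x - f a) ^ θ) a :=
        (((hf a haX).continuousAt.sub continuousAt_const).rpow_const (Or.inr hθ0.le)).const_mul c
      refine h1.eventually (gt_mem_nhds ?_)
      simpa [Real.zero_rpow hθ0.ne'] using hρ0
  obtain ⟨t₁, ⟨h1, h2⟩, ht₁⟩ := ((ha.frequently hev).and_eventually (eventually_ge_atTop 0)).exists
  have hlen : ∀ t, t₁ ≤ t → ‖φ t - φ t₁‖ ≤ ρ := by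
    intro t ht
    set H : ℝ → ℝ := fun t => (f (φ t) - f a) ^ θ
    have hHpos : ∀ s, 0 ≤ s → 0 < H s := fun s hs => Real.rpow_pos_of_pos (sub_pos.2 (hgt s hs)) _
    have hHd : ∀ s, t₁ ≤ s → HasDerivWithinAt H
        (-‖gradient f (φ s)‖ ^ 2 * θ * (f (φ s) - f a) ^ (θ - 1)) (Ici t₁) s := fun s hs =>
      ((hφ.energy hf ht₁ hs).sub_const (f a)).rpow_const
        (Or.inl (sub_pos.2 (hgt s (ht₁.trans hs))).ne')
    have hmain := image_norm_le_of_norm_deriv_right_lt_deriv_boundary' (a := t₁) (b := t)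
      (f := fun s => φ s - φ t₁) (f' := fun s => -gradient f (φ s))
      (B := fun s => c * (H t₁ - H s))
      (B' := fun s => c * (‖gradient f (φ s)‖ ^ 2 * θ * (f (φ s) - f a) ^ (θ - 1)))
      (fun s hs => (((hφ.hasDerivWithinAt ht₁ hs.1).sub_const _).continuousWithinAt).mono
        Icc_subset_Ici_self)
      (fun s hs => ((hφ.hasDerivWithinAt ht₁ hs.1).sub_const _).mono (Ici_subset_Ici.2 hs.1))
      (by simp)
      (fun s hs => ((((hHd s hs.1).const_sub _).const_mul c).continuousWithinAt).mono
        Icc_subset_Ici_self)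
      (fun s hs => by
        have := (((hHd s hs.1).const_sub (H t₁)).const_mul c).mono (Ici_subset_Ici.2 hs.1)
        refine this.congr_deriv ?_
        ring)
      (fun s hs hsB => ?_) (right_mem_Icc.2 ht)
    · refine hmain.trans ?_
      have h3 := hHpos t (ht₁.trans ht)
      have h4 : c * (H t₁ - H t) ≤ c * H t₁ := mul_le_mul_of_nonneg_left (by linarith) hc0.le
      exact h4.trans h2.le
    · have hs0 : 0 ≤ s := ht₁.trans hs.1
      have hv := sub_pos.2 (hgt s hs0)
      set v := f (φ s) - f a
      have hin : φ s ∈ Metric.ball a r := by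
        rw [Metric.mem_ball, dist_eq_norm]
        have h3 := hHpos s hs0
        have h4 : c * (H t₁ - H s) ≤ c * H t₁ := mul_le_mul_of_nonneg_left (by linarith) hc0.le
        have h5 : ‖φ s - a‖ ≤ ‖φ s - φ t₁‖ + ‖φ t₁ - a‖ := norm_sub_le_norm_sub_add_norm_sub _ _ _
        have h6 : 2 * ρ ≤ r := by rw [hρ]; linarith [min_le_right ε r]
        have h7 : c * H t₁ < ρ := h2
        linarith
      have hl := hball _ hin
      rw [← norm_gradient, abs_of_pos hv] at hl
      set D := ‖gradient f (φ s)‖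
      have hD : 0 < D := by
        by_contra hD
        have hD0 : D = 0 := le_antisymm (not_lt.1 hD) (norm_nonneg _)
        rw [hD0, mul_zero, zero_pow (Nat.succ_ne_zero m)] at hl
        exact absurd hl (not_le.2 (by positivity))
      have hroot : v ^ (1 - θ) ≤ C * D := by
        have h3 : v ^ (1 - θ) = (v ^ m) ^ θ := by
          rw [← Real.rpow_natCast, ← Real.rpow_mul hv.le]
          congr 1
          rw [hθ]
          push_cast
          field_simp
          ring
        rw [h3]
        calc (v ^ m) ^ θ ≤ ((C * D) ^ (m + 1)) ^ θ :=
              Real.rpow_le_rpow (by positivity) hl hθ0.le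
          _ = C * D := Real.pow_rpow_inv_natCast (by positivity) (Nat.succ_ne_zero m)
      have hone : v ^ (1 - θ) * v ^ (θ - 1) = 1 := by
        rw [← Real.rpow_add hv]
        simp
      have hvp : 0 < v ^ (θ - 1) := Real.rpow_pos_of_pos hv _
      have h8 : 1 ≤ C * D * v ^ (θ - 1) := by
        refine hone.symm.trans_le ?_
        exact mul_le_mul_of_nonneg_right hroot hvp.le
      change ‖-gradient f (φ s)‖ < c * (D ^ 2 * θ * v ^ (θ - 1))
      rw [norm_neg]
      have h9 : c * (D ^ 2 * θ * v ^ (θ - 1)) = 2 * D * (C * D * v ^ (θ - 1)) := by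
        rw [hc]; field_simp
      rw [h9]
      change D < _
      nlinarith
  refine ⟨t₁, fun t ht => ?_⟩
  rw [dist_eq_norm]
  have h5 : ‖φ t - a‖ ≤ ‖φ t - φ t₁‖ + ‖φ t₁ - a‖ := norm_sub_le_norm_sub_add_norm_sub _ _ _
  have h6 : 2 * ρ ≤ ε := by rw [hρ]; linarith [min_le_left ε r]
  linarith [hlen t ht]

/-- Limits of gradient trajectories are critical points. -/
theorem IsTrajectory.gradient_eq_zero (hφ : IsTrajectory f X φ) {a : F}
    (hfa : AnalyticAt ℝ f a) (hlim : Tendsto φ atTop (𝓝 a)) : gradient f a = 0 := by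
  have hgrad : Tendsto (fun t => gradient f (φ t)) atTop (𝓝 (gradient f a)) :=
    (analyticAt_gradient hfa).continuousAt.tendsto.comp hlim
  by_contra hne
  set w := gradient f a
  have hw : 0 < ‖w‖ := norm_pos_iff.2 hne
  obtain ⟨T₁, hT₁⟩ := Metric.tendsto_atTop.1 hgrad (‖w‖ / 4) (by positivity)
  obtain ⟨T₂, hT₂⟩ := Metric.tendsto_atTop.1 hlim (‖w‖ / 4) (by positivity)
  set T := max 0 (max T₁ T₂)
  have hT0 : 0 ≤ T := le_max_left _ _
  have hT1 : T₁ ≤ T := (le_max_left _ _).trans (le_max_right _ _)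
  have hT2 : T₂ ≤ T := (le_max_right _ _).trans (le_max_right _ _)
  have hmv := Convex.norm_image_sub_le_of_norm_hasDerivWithin_le (f := fun t => φ t + t • w)
    (f' := fun t => -gradient f (φ t) + w) (C := ‖w‖ / 4) (s := Ici T) (x := T) (y := T + 1)
    (fun s hs => by
      simpa [Pi.add_def] using (hφ.hasDerivWithinAt hT0 hs).add
        ((hasDerivAt_id s).smul_const w).hasDerivWithinAt)
    (fun s hs => by
      have := (hT₁ s (hT1.trans hs)).le
      rwa [dist_eq_norm, norm_sub_rev, sub_eq_neg_add] at this)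
    (convex_Ici T) self_mem_Ici (by simp)
  have e1 := hT₂ T hT2
  have e2 := hT₂ (T + 1) (by linarith)
  rw [dist_eq_norm] at e1 e2
  have e3 : w = (φ (T + 1) + (T + 1) • w - (φ T + T • w)) - (φ (T + 1) - a) + (φ T - a) := by
    rw [add_smul, one_smul]; abel
  have e4 : ‖w‖ ≤ ‖φ (T + 1) + (T + 1) • w - (φ T + T • w)‖ + ‖φ (T + 1) - a‖ + ‖φ T - a‖ := by
    conv_lhs => rw [e3]
    exact (norm_add_le _ _).trans (by gcongr; exact norm_sub_le _ _)
  simp at hmv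
  linarith

/-- Precompact gradient trajectories of analytic functions converge to critical points. -/
theorem IsTrajectory.exists_tendsto [FiniteDimensional ℝ F] (hφ : IsTrajectory f X φ)
    (hf : AnalyticOnNhd ℝ f X) {K : Set F} (hK : IsCompact K) (hKX : K ⊆ X)
    (hφK : ∀ t ∈ Ici (0 : ℝ), φ t ∈ K) :
    ∃ a ∈ K, gradient f a = 0 ∧ Tendsto φ atTop (𝓝 a) := by
  obtain ⟨a, haK, ha⟩ := hK.exists_mapClusterPt_of_frequently (l := atTop) (f := φ)
    ((eventually_ge_atTop 0).mono fun t ht => hφK t ht).frequently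
  have hfa := hf a (hKX haK)
  suffices Tendsto φ atTop (𝓝 a) from ⟨a, haK, hφ.gradient_eq_zero hfa this, this⟩
  have hanti := hφ.antitoneOn_energy hf
  have hge : ∀ t, 0 ≤ t → f a ≤ f (φ t) := by
    intro t ht
    by_contra! hlt
    obtain ⟨s, hs, hts⟩ := ((ha.frequently (hfa.continuousAt.eventually (lt_mem_nhds hlt))
      ).and_eventually (eventually_ge_atTop t)).exists
    exact absurd (hanti ht (ht.trans hts) hts) (not_le.2 hs)
  by_cases hex : ∃ t₀, 0 ≤ t₀ ∧ f (φ t₀) = f a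
  · obtain ⟨t₀, ht₀, h⟩ := hex
    exact hφ.tendsto_of_energy_eq hf ha ht₀ fun t ht =>
      le_antisymm ((hanti ht₀ (ht₀.trans ht) ht).trans_eq h) (hge t (ht₀.trans ht))
  · push Not at hex
    exact hφ.tendsto_of_energy_gt hf (hKX haK) ha fun t ht =>
      lt_of_le_of_ne (hge t ht) (hex t ht).symm

end GradientFlow

namespace GradientFlow

theorem exp_mul_le_of_mul_le_deriv {V V' : ℝ → ℝ} {k t₀ : ℝ}
    (hV : ∀ t ∈ Ici t₀, HasDerivWithinAt V (V' t) (Ici t₀) t)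
    (h : ∀ t ∈ Ici t₀, k * V t ≤ V' t) {t : ℝ} (ht : t₀ ≤ t) :
    Real.exp (k * (t - t₀)) * V t₀ ≤ V t := by
  have hexp : ∀ s : ℝ, HasDerivAt (fun s => Real.exp (-(k * (s - t₀))))
      (Real.exp (-(k * (s - t₀))) * -k) s := by
    intro s
    refine HasDerivAt.exp ?_
    simpa using (((hasDerivAt_id s).sub_const t₀).const_mul k).fun_neg
  have hW : ∀ s ∈ Ici t₀, HasDerivWithinAt (fun s => Real.exp (-(k * (s - t₀))) * V s)
      (Real.exp (-(k * (s - t₀))) * -k * V s + Real.exp (-(k * (s - t₀))) * V' s) (Ici t₀) s :=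
    fun s hs => (hexp s).hasDerivWithinAt.mul (hV s hs)
  have hmono := monotoneOn_of_hasDerivWithinAt_nonneg (convex_Ici t₀)
    (fun s hs => (hW s hs).continuousWithinAt)
    (fun s hs => (hW s (interior_subset hs)).mono interior_subset) (fun s hs => by
      have h1 := h s (interior_subset hs)
      have h2 := Real.exp_pos (-(k * (s - t₀)))
      nlinarith)
  have h3 := hmono self_mem_Ici ht ht
  simp only [sub_self, mul_zero, neg_zero, Real.exp_zero, one_mul] at h3
  have h4 := mul_le_mul_of_nonneg_left h3 (Real.exp_pos (k * (t - t₀))).le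
  rwa [← mul_assoc, ← Real.exp_add, add_neg_cancel, Real.exp_zero, one_mul] at h4

variable {F : Type*} [NormedAddCommGroup F] [InnerProductSpace ℝ F] [CompleteSpace F]
variable {f : F → ℝ} {X : Set F} {φ ψ : ℝ → F}

/-- Backward Grönwall estimate for two trajectories along which the gradient is Lipschitz. -/
theorem IsTrajectory.norm_sub_le (hφ : IsTrajectory f X φ) (hψ : IsTrajectory f X ψ)
    {L : ℝ} {K : Set F} (hL : ∀ x ∈ K, ∀ y ∈ K, ‖gradient f x - gradient f y‖ ≤ L * ‖x - y‖)
    (hφK : ∀ t ∈ Ici (0 : ℝ), φ t ∈ K) (hψK : ∀ t ∈ Ici (0 : ℝ), ψ t ∈ K) {T : ℝ} (hT : 0 ≤ T) :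
    ‖φ 0 - ψ 0‖ ≤ Real.exp (L * T) * ‖φ T - ψ T‖ := by
  have hd : ∀ t ∈ Ici (0 : ℝ), HasDerivWithinAt (fun t => ‖φ t - ψ t‖ ^ 2)
      (2 * inner ℝ (φ t - ψ t) (-gradient f (φ t) - -gradient f (ψ t))) (Ici 0) t := fun t ht =>
    ((hφ t ht).2.sub (hψ t ht).2).norm_sq
  have h := exp_mul_le_of_mul_le_deriv (k := -(2 * L)) hd (fun t ht => by
    have h1 := abs_real_inner_le_norm (φ t - ψ t) (-gradient f (φ t) - -gradient f (ψ t))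
    have h2 := hL _ (hφK t ht) _ (hψK t ht)
    have h3 : ‖-gradient f (φ t) - -gradient f (ψ t)‖ = ‖gradient f (φ t) - gradient f (ψ t)‖ := by
      rw [← norm_neg]; congr 1; abel
    rw [h3] at h1
    have h4 := neg_le_of_abs_le h1
    nlinarith [norm_nonneg (φ t - ψ t)]) hT
  rw [sub_zero] at h
  have h5 : ‖φ 0 - ψ 0‖ ^ 2 ≤ (Real.exp (L * T) * ‖φ T - ψ T‖) ^ 2 := by
    have h6 := mul_le_mul_of_nonneg_left h (Real.exp_pos (2 * L * T)).le
    rw [← mul_assoc, ← Real.exp_add] at h6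
    have h7 : 2 * L * T + -(2 * L) * T = 0 := by ring
    rw [h7, Real.exp_zero, one_mul] at h6
    rw [mul_pow, ← Real.exp_nat_mul, Nat.cast_ofNat, ← mul_assoc]
    exact h6
  exact (sq_le_sq₀ (norm_nonneg _) (by positivity)).1 h5

/-- Data witnessing that the gradient is uniformly close, on `U`, to a symmetric linear map with
a negative eigenvalue. -/
def IsSaddleRegion {ι : Type*} [Fintype ι] (b : OrthonormalBasis ι ℝ F) (μ : ι → ℝ) (A : F →L[ℝ] F)
    (l : ℝ) (f : F → ℝ) (U : Set F) : Prop :=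
  (∀ i v, inner ℝ (b i) (A v) = μ i * inner ℝ (b i) v) ∧ 0 < l ∧ (∀ i, μ i < 0 → μ i ≤ -l) ∧
    ∀ x ∈ U, ∀ y ∈ U, ‖gradient f x - gradient f y - A (x - y)‖ ≤ l / 4 * ‖x - y‖

variable {ι : Type*} [Fintype ι] {b : OrthonormalBasis ι ℝ F} {μ : ι → ℝ} {A : F →L[ℝ] F} {l : ℝ}
  {U : Set F}

/-- Two bounded trajectories which stay near a saddle differ by a vector in the cone around the
center-stable directions. -/
theorem IsSaddleRegion.cone (hU : IsSaddleRegion b μ A l f U) (hφ : IsTrajectory f X φ)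
    (hψ : IsTrajectory f X ψ) {T : ℝ} (hT : 0 ≤ T) (hφU : ∀ t ∈ Ici T, φ t ∈ U)
    (hψU : ∀ t ∈ Ici T, ψ t ∈ U) {R : ℝ} (hR : ∀ t ∈ Ici T, ‖φ t - ψ t‖ ≤ R) :
    ∑ i, (if μ i < 0 then 1 else -1) * inner ℝ (b i) (φ T - ψ T) ^ 2 ≤ 0 := by
  obtain ⟨hA, hl, hμ, hUA⟩ := hU
  set σ : ι → ℝ := fun i => if μ i < 0 then 1 else -1 with hσ
  set c : ι → ℝ → ℝ := fun i t => inner ℝ (b i) (φ t - ψ t)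
  set e : ι → ℝ → ℝ := fun i t =>
    inner ℝ (b i) (gradient f (φ t) - gradient f (ψ t) - A (φ t - ψ t))
  have hc : ∀ i, ∀ t ∈ Ici T, HasDerivWithinAt (c i) (-(μ i * c i t) - e i t) (Ici T) t := by
    intro i t ht
    have h1 := (innerSL ℝ (b i)).hasFDerivAt.comp_hasDerivWithinAt t
      ((hφ.hasDerivWithinAt hT ht).sub (hψ.hasDerivWithinAt hT ht))
    refine h1.congr_deriv ?_
    simp only [c, e, ← hA, innerSL_apply_apply, ← inner_neg_right, ← inner_sub_right]
    congr 1
    abel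
  have hV : ∀ t ∈ Ici T, HasDerivWithinAt (fun t => ∑ i, σ i * c i t ^ 2)
      (∑ i, σ i * (2 * c i t * (-(μ i * c i t) - e i t))) (Ici T) t := by
    intro t ht
    refine HasDerivWithinAt.fun_sum fun i _ => ?_
    simpa using ((hc i t ht).fun_pow 2).const_mul (σ i)
  have hgrow : ∀ t ∈ Ici T, l / 2 * ∑ i, σ i * c i t ^ 2 ≤
      ∑ i, σ i * (2 * c i t * (-(μ i * c i t) - e i t)) := by
    intro t ht
    have hsc : ∑ i, c i t ^ 2 = ‖φ t - ψ t‖ ^ 2 := by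
      simpa using b.sum_sq_norm_inner_right (φ t - ψ t)
    have hse : ∑ i, e i t ^ 2 = ‖gradient f (φ t) - gradient f (ψ t) - A (φ t - ψ t)‖ ^ 2 := by
      have h := b.sum_sq_norm_inner_right (gradient f (φ t) - gradient f (ψ t) - A (φ t - ψ t))
      simp only [Real.norm_eq_abs, sq_abs] at h
      exact h
    have hes : ∑ i, e i t ^ 2 ≤ (l / 4) ^ 2 * ∑ i, c i t ^ 2 := by
      rw [hsc, hse, ← mul_pow]
      exact pow_le_pow_left₀ (norm_nonneg _) (hUA _ (hφU t ht) _ (hψU t ht)) 2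
    have hterm : ∀ i, l / 2 * (σ i * c i t ^ 2) ≤
        σ i * (2 * c i t * (-(μ i * c i t) - e i t)) +
          (e i t ^ 2 / (l / 4) - l / 4 * c i t ^ 2) := by
      intro i
      have hsq : σ i * (2 * c i t * e i t) ≤ l / 4 * c i t ^ 2 + e i t ^ 2 / (l / 4) := by
        have h1 : σ i ^ 2 = 1 := by
          simp only [hσ]; split_ifs <;> norm_num
        have h2 : 0 ≤ (l / 4 * (σ i * c i t) - e i t) ^ 2 / (l / 4) := by positivity
        have h3 : (l / 4 * (σ i * c i t) - e i t) ^ 2 / (l / 4) =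
            l / 4 * (σ i ^ 2 * c i t ^ 2) - σ i * (2 * c i t * e i t) + e i t ^ 2 / (l / 4) := by
          field_simp
          ring
        rw [h3, h1, one_mul] at h2
        linarith
      have hdiag : l / 2 * (σ i * c i t ^ 2) ≤
          -(2 * σ i * μ i) * c i t ^ 2 - l / 2 * c i t ^ 2 := by
        by_cases hi : μ i < 0
        · simp only [hσ, if_pos hi]
          nlinarith [hμ i hi, sq_nonneg (c i t)]
        · simp only [hσ, if_neg hi]
          nlinarith [sq_nonneg (c i t)]
      linarith
    have hsum := Finset.sum_le_sum fun i (_ : i ∈ Finset.univ) => hterm i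
    rw [← Finset.mul_sum, Finset.sum_add_distrib, Finset.sum_sub_distrib, ← Finset.mul_sum,
      ← Finset.sum_div] at hsum
    have h4 : (∑ i, e i t ^ 2) / (l / 4) ≤ l / 4 * ∑ i, c i t ^ 2 := by
      rw [div_le_iff₀ (by positivity)]
      linarith
    linarith
  change ∑ i, σ i * c i T ^ 2 ≤ 0
  by_contra! hpos
  have hbound : ∀ t ∈ Ici T, ∑ i, σ i * c i t ^ 2 ≤ R ^ 2 := by
    intro t ht
    calc ∑ i, σ i * c i t ^ 2 ≤ ∑ i, c i t ^ 2 := by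
          refine Finset.sum_le_sum fun i _ => ?_
          simp only [hσ]
          split_ifs <;> nlinarith [sq_nonneg (c i t)]
      _ = ‖φ t - ψ t‖ ^ 2 := by simpa using b.sum_sq_norm_inner_right (φ t - ψ t)
      _ ≤ R ^ 2 := pow_le_pow_left₀ (norm_nonneg _) (hR t ht) 2
  have hlim : Tendsto (fun t => Real.exp (l / 2 * (t - T)) * ∑ i, σ i * c i T ^ 2) atTop atTop := by
    refine Tendsto.atTop_mul_const hpos (Real.tendsto_exp_atTop.comp ?_)
    exact (tendsto_atTop_add_const_right _ _ tendsto_id).const_mul_atTop (by positivity)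
  obtain ⟨t, ht, htT⟩ := ((hlim.eventually_gt_atTop (R ^ 2)).and (eventually_ge_atTop T)).exists
  exact absurd (ht.trans_le ((exp_mul_le_of_mul_le_deriv hV hgrow htT).trans (hbound t htT)))
    (lt_irrefl _)

theorem IsSaddleRegion.norm_sub_le (hU : IsSaddleRegion b μ A l f U) (hφ : IsTrajectory f X φ)
    (hψ : IsTrajectory f X ψ) {T : ℝ} (hT : 0 ≤ T) (hφU : ∀ t ∈ Ici T, φ t ∈ U)
    (hψU : ∀ t ∈ Ici T, ψ t ∈ U) {R : ℝ} (hR : ∀ t ∈ Ici T, ‖φ t - ψ t‖ ≤ R) :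
    ‖φ T - ψ T‖ ≤ Real.sqrt (2 * Fintype.card ι) *
      ‖fun i : {i // 0 ≤ μ i} => inner ℝ (b i) (φ T - ψ T)‖ := by
  have hcone := hU.cone hφ hψ hT hφU hψU hR
  set v := φ T - ψ T
  set M := ‖fun i : {i // 0 ≤ μ i} => inner ℝ (b i) v‖
  have hM : 0 ≤ M := norm_nonneg _
  have hsum : ∑ i, inner ℝ (b i) v ^ 2 = ‖v‖ ^ 2 := by
    simpa using b.sum_sq_norm_inner_right v
  have hterm : ∀ i, inner ℝ (b i) v ^ 2 ≤
      (if μ i < 0 then 1 else -1) * inner ℝ (b i) v ^ 2 + 2 * M ^ 2 := by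
    intro i
    by_cases hi : μ i < 0
    · rw [if_pos hi]
      nlinarith [sq_nonneg M]
    · rw [if_neg hi]
      have h1 : ‖inner ℝ (b i) v‖ ≤ M :=
        norm_le_pi_norm (fun i : {i // 0 ≤ μ i} => inner ℝ (b i) v) ⟨i, not_lt.1 hi⟩
      have h2 : inner ℝ (b i) v ^ 2 ≤ M ^ 2 := sq_le_sq' (neg_le_of_abs_le h1) (le_of_abs_le h1)
      linarith
  have h3 := Finset.sum_le_sum fun i (_ : i ∈ Finset.univ) => hterm i
  rw [hsum, Finset.sum_add_distrib, Finset.sum_const, Finset.card_univ, nsmul_eq_mul] at h3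
  have h4 : ‖v‖ ^ 2 ≤ (Real.sqrt (2 * Fintype.card ι) * M) ^ 2 := by
    rw [mul_pow, Real.sq_sqrt (by positivity)]
    linarith
  exact (sq_le_sq₀ (norm_nonneg _) (by positivity)).1 h4

end GradientFlow

namespace GradientFlow

variable {F : Type*} [NormedAddCommGroup F] [InnerProductSpace ℝ F]

theorem exists_norm_gradient_sub_le [CompleteSpace F] {f : F → ℝ} {X K : Set F}
    (hf : AnalyticOnNhd ℝ f X) (hK : IsCompact K) (hKX : K ⊆ X) :
    ∃ L : ℝ, ∀ x ∈ K, ∀ y ∈ K, ‖gradient f x - gradient f y‖ ≤ L * ‖x - y‖ := by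
  obtain ⟨L, hL⟩ := LocallyLipschitzOn.exists_lipschitzOnWith_of_compact (f := gradient f) hK
    fun x hx => by
      obtain ⟨C, t, ht, hC⟩ :=
        (analyticAt_gradient (hf x (hKX hx))).contDiffAt.exists_lipschitzOnWith
      exact ⟨C, t, mem_nhdsWithin_of_mem_nhds ht, hC⟩
  exact ⟨L, fun x hx y hy => hL.norm_sub_le hx hy⟩

/-- A set on which distances are controlled by a map to a space of lower dimension is null. -/
theorem measure_zero_of_norm_sub_le [FiniteDimensional ℝ F] [MeasurableSpace F] [BorelSpace F]
    (ν : Measure F) [ν.IsAddHaarMeasure] {κ : Type*} [Fintype κ]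
    (hκ : Fintype.card κ < Module.finrank ℝ F) {Φ : F → κ → ℝ} {s : Set F} {C : ℝ}
    (hC : 0 ≤ C) (h : ∀ x ∈ s, ∀ y ∈ s, ‖x - y‖ ≤ C * ‖Φ x - Φ y‖) : ν s = 0 := by
  have hν : ν ≪ μH[((Module.finrank ℝ F : NNReal) : ℝ)] := by
    rw [NNReal.coe_natCast]
    exact Measure.absolutelyContinuous_isAddHaarMeasure _ _
  refine measure_zero_of_dimH_lt hν ?_
  rcases s.eq_empty_or_nonempty with rfl | hs
  · rw [dimH_empty]
    exact_mod_cast (Nat.zero_le _).trans_lt hκ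
  have hinj : InjOn Φ s := fun x hx y hy hxy => by
    have h1 := h x hx y hy
    rw [hxy, sub_self, norm_zero, mul_zero] at h1
    exact sub_eq_zero.1 (norm_le_zero_iff.1 h1)
  have : Nonempty F := ⟨0⟩
  have hinv : ∀ x ∈ s, Function.invFunOn Φ s (Φ x) = x := fun x hx =>
    hinj.leftInvOn_invFunOn hx
  have hlip : LipschitzOnWith C.toNNReal (Function.invFunOn Φ s) (Φ '' s) := by
    refine LipschitzOnWith.of_dist_le_mul ?_
    rintro _ ⟨x, hx, rfl⟩ _ ⟨y, hy, rfl⟩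
    rw [hinv x hx, hinv y hy, dist_eq_norm, dist_eq_norm, Real.coe_toNNReal _ hC]
    exact h x hx y hy
  have himage : Function.invFunOn Φ s '' (Φ '' s) = s := by
    rw [image_image]
    exact (image_congr hinv).trans (image_id' s)
  calc dimH s = dimH (Function.invFunOn Φ s '' (Φ '' s)) := by rw [himage]
    _ ≤ dimH (Φ '' s) := hlip.dimH_image_le
    _ ≤ dimH (univ : Set (κ → ℝ)) := dimH_mono (subset_univ _)
    _ = (Fintype.card κ : ENNReal) := Real.dimH_univ_pi κ
    _ < _ := by
      rw [ENNReal.coe_natCast]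
      exact_mod_cast hκ

variable [FiniteDimensional ℝ F] {f : F → ℝ} {X K U : Set F} {ι : Type*} [Fintype ι] {b : OrthonormalBasis ι ℝ F}
  {μ : ι → ℝ} {A : F →L[ℝ] F} {l T : ℝ}

theorem exists_isSaddleRegion {x : F} (hf : AnalyticAt ℝ f x) (hA : HasFDerivAt (gradient f) A x)
    (hb : ∀ i v, inner ℝ (b i) (A v) = μ i * inner ℝ (b i) v) (hμ : ∃ i, μ i < 0) :
    ∃ l, ∃ U ∈ 𝓝 x, IsSaddleRegion b μ A l f U := by
  classical
  obtain ⟨i, hi⟩ := hμ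
  obtain ⟨j, hj, hmax⟩ := Finset.exists_max_image {i | μ i < 0} μ
    ⟨i, Finset.mem_filter.2 ⟨Finset.mem_univ i, hi⟩⟩
  have hj0 : μ j < 0 := (Finset.mem_filter.1 hj).2
  have hc : (0 : NNReal) < (-μ j / 4).toNNReal := Real.toNNReal_pos.2 (by linarith)
  have hstrict := (analyticAt_gradient hf).hasStrictFDerivAt
  rw [hA.fderiv] at hstrict
  obtain ⟨U, hU, happrox⟩ := hstrict.approximates_deriv_on_nhds (Or.inr hc)
  refine ⟨-μ j, U, hU, hb, by linarith, fun k hk => ?_, fun y hy z hz => ?_⟩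
  · rw [neg_neg]
    exact hmax k (Finset.mem_filter.2 ⟨Finset.mem_univ k, hk⟩)
  · have h := happrox y hy z hz
    rwa [Real.coe_toNNReal _ (by linarith)] at h

theorem inner_eigenvectorBasis_toEuclideanCLM {n : Type*} [Fintype n] [DecidableEq n]
    {H : Matrix n n ℝ} (hH : H.IsHermitian) (i : n) (v : EuclideanSpace ℝ n) :
    inner ℝ (hH.eigenvectorBasis i) (Matrix.toEuclideanCLM (𝕜 := ℝ) H v) =
      hH.eigenvalues i * inner ℝ (hH.eigenvectorBasis i) v := by
  have h1 := Matrix.isSymmetric_toEuclideanLin_iff.2 hH (hH.eigenvectorBasis i) v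
  have h2 : Matrix.toEuclideanLin H (hH.eigenvectorBasis i) =
      hH.eigenvalues i • hH.eigenvectorBasis i :=
    congrArg (WithLp.toLp 2) (hH.mulVec_eigenvectorBasis i)
  rw [h2, real_inner_smul_left] at h1
  exact h1.symm

/-- A saddle region with a negative eigenvalue, with the linearization data existentially
quantified. -/
def IsUnstableRegion (ι : Type*) [Fintype ι] (f : F → ℝ) (U : Set F) : Prop :=
  ∃ (b : OrthonormalBasis ι ℝ F) (μ : ι → ℝ) (A : F →L[ℝ] F) (l : ℝ),
    IsSaddleRegion b μ A l f U ∧ ∃ i, μ i < 0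

theorem IsUnstableRegion.mono {V : Set F} (hU : IsUnstableRegion ι f U) (hV : V ⊆ U) :
    IsUnstableRegion ι f V := by
  obtain ⟨b, μ, A, l, ⟨hA, hl, hμ, h⟩, hneg⟩ := hU
  exact ⟨b, μ, A, l, ⟨hA, hl, hμ, fun x hx y hy => h x (hV hx) y (hV hy)⟩, hneg⟩

variable [MeasurableSpace F] [BorelSpace F]

/-- The local center-stable set of a saddle is null. -/
theorem IsSaddleRegion.measure_zero (ν : Measure F) [ν.IsAddHaarMeasure]
    (hU : IsSaddleRegion b μ A l f U) (hμ : ∃ i, μ i < 0) (hf : AnalyticOnNhd ℝ f X)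
    (hK : IsCompact K) (hKX : K ⊆ X) (hT : 0 ≤ T) :
    ν {ξ | ∃ φ, φ 0 = ξ ∧ IsTrajectory f X φ ∧ (∀ t ∈ Ici (0 : ℝ), φ t ∈ K) ∧
      ∀ t ∈ Ici T, φ t ∈ U} = 0 := by
  obtain ⟨L, hL⟩ := exists_norm_gradient_sub_le hf hK hKX
  obtain ⟨R, hR⟩ := Metric.isBounded_iff.1 hK.isBounded
  set s := {ξ | ∃ φ, φ 0 = ξ ∧ IsTrajectory f X φ ∧ (∀ t ∈ Ici (0 : ℝ), φ t ∈ K) ∧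
    ∀ t ∈ Ici T, φ t ∈ U}
  have hs : ∀ ξ, ∃ φ : ℝ → F, ξ ∈ s → φ 0 = ξ ∧ IsTrajectory f X φ ∧
      (∀ t ∈ Ici (0 : ℝ), φ t ∈ K) ∧ ∀ t ∈ Ici T, φ t ∈ U := by
    intro ξ
    by_cases hξ : ξ ∈ s
    · obtain ⟨φ, hφ⟩ := hξ
      exact ⟨φ, fun _ => hφ⟩
    · exact ⟨fun _ => 0, fun h => absurd h hξ⟩
  choose φ hφ using hs
  obtain ⟨i, hi⟩ := hμ
  have hcard : Fintype.card {i // 0 ≤ μ i} < Module.finrank ℝ F := by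
    rw [Module.finrank_eq_card_basis b.toBasis]
    exact Fintype.card_subtype_lt (not_le.2 hi)
  refine measure_zero_of_norm_sub_le ν hcard
    (Φ := fun ξ (i : {i // 0 ≤ μ i}) => inner ℝ (b i) (φ ξ T))
    (C := Real.exp (L * T) * Real.sqrt (2 * Fintype.card ι)) (by positivity) fun ξ hξ η hη => ?_
  obtain ⟨hξ0, hξ, hξK, hξU⟩ := hφ ξ hξ
  obtain ⟨hη0, hη, hηK, hηU⟩ := hφ η hη
  have h1 := hξ.norm_sub_le hη hL hξK hηK hT
  have h2 := hU.norm_sub_le hξ hη hT hξU hηU (R := R) fun t ht => by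
    rw [← dist_eq_norm]
    exact hR (hξK t (hT.trans ht)) (hηK t (hT.trans ht))
  rw [hξ0, hη0] at h1
  refine h1.trans ?_
  rw [mul_assoc]
  refine mul_le_mul_of_nonneg_left (h2.trans_eq ?_) (Real.exp_pos _).le
  congr 2
  ext i
  simp [inner_sub_right]

theorem measure_zero_of_tendsto (ν : Measure F) [ν.IsAddHaarMeasure] (ι : Type*) [Fintype ι]
    (hX : IsOpen X) (hf : AnalyticOnNhd ℝ f X) {S : Set F}
    (hS : ∀ x ∈ S, ∃ U ∈ 𝓝 x, IsUnstableRegion ι f U) :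
    ν {ξ | ∃ φ, φ 0 = ξ ∧ IsTrajectory f X φ ∧
      (∃ K, IsCompact K ∧ K ⊆ X ∧ ∀ t ∈ Ici (0 : ℝ), φ t ∈ K) ∧
      ∃ x ∈ S, Tendsto φ atTop (𝓝 x)} = 0 := by
  have : LocallyCompactSpace X := hX.locallyCompactSpace
  set E := CompactExhaustion.choice X
  have hnull : ∀ V ∈ {V ∈ TopologicalSpace.countableBasis F | IsUnstableRegion ι f V},
      ν (⋃ (m : ℕ) (N : ℕ), {ξ | ∃ φ, φ 0 = ξ ∧ IsTrajectory f X φ ∧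
        (∀ t ∈ Ici (0 : ℝ), φ t ∈ Subtype.val '' E m) ∧ ∀ t ∈ Ici (N : ℝ), φ t ∈ V}) = 0 := by
    rintro V ⟨-, b, μ, A, l, hV, hneg⟩
    refine measure_iUnion_null fun m => measure_iUnion_null fun N => ?_
    exact hV.measure_zero ν hneg hf ((E.isCompact m).image continuous_subtype_val)
      (Subtype.coe_image_subset X _) (Nat.cast_nonneg N)
  have hcount : {V ∈ TopologicalSpace.countableBasis F | IsUnstableRegion ι f V}.Countable :=
    (TopologicalSpace.countable_countableBasis F).mono (sep_subset _ _)
  refine measure_mono_null ?_ ((measure_biUnion_null_iff hcount).2 hnull)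
  rintro ξ ⟨φ, h0, hφ, ⟨K, hK, hKX, hφK⟩, x, hx, hlim⟩
  obtain ⟨U, hU, hUS⟩ := hS x hx
  obtain ⟨V, hVB, hxV, hVU⟩ :=
    (TopologicalSpace.isBasis_countableBasis F).mem_nhds_iff.1 hU
  have hV : V ∈ 𝓝 x := (TopologicalSpace.isOpen_of_mem_countableBasis hVB).mem_nhds hxV
  obtain ⟨T, hT⟩ := eventually_atTop.1 (hlim.eventually hV)
  have hK' : IsCompact ((Subtype.val : X → F) ⁻¹' K) :=
    (Topology.IsInducing.subtypeVal.isCompact_preimage_iff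
      (by rwa [Subtype.range_coe])).2 hK
  obtain ⟨m, hm⟩ := E.exists_superset_of_isCompact hK'
  obtain ⟨N, hN⟩ := exists_nat_ge T
  refine mem_biUnion ⟨hVB, hUS.mono hVU⟩ (mem_iUnion₂.2 ⟨m, N, φ, h0, hφ, fun t ht => ?_,
    fun t ht => hT t (hN.trans ht)⟩)
  exact ⟨⟨φ t, (hφ t ht).1⟩, hm (hφK t ht), rfl⟩

end GradientFlow

end

/-- **Almost-everywhere convergence of analytic gradient flows with strict saddles.**
Let `ℒ : 𝕏 → ℝ₊` be real-analytic on an open set `𝕏 ⊆ ℝⁿ`, suppose its critical set splits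
as `Z = M ∪ S` with `M` the global minimizers and every point of `S` a strict saddle of
`ẋ = -∇ℒ(x)` (the Hessian has a strictly negative and a nonnegative eigenvalue), and assume
from every initial point the forward gradient-flow solution exists for all `t ≥ 0` and stays
in a compact subset of `𝕏` (precompactness of trajectories).  Then the set of initial points
whose solution does not converge to a point of `M` has Lebesgue measure zero. -/
theorem analytic_gradient_flow_ae_convergence {n : ℕ}
    (𝕏 : Set (EuclideanSpace ℝ (Fin n))) (hX : IsOpen 𝕏)
    (ℒ : EuclideanSpace ℝ (Fin n) → ℝ)
    (han : AnalyticOnNhd ℝ ℒ 𝕏) (hnonneg : ∀ x ∈ 𝕏, 0 ≤ ℒ x)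
    (S : Set (EuclideanSpace ℝ (Fin n)))
    (hZ : {x | x ∈ 𝕏 ∧ gradient ℒ x = 0}
        = {x | x ∈ 𝕏 ∧ ∀ y ∈ 𝕏, ℒ x ≤ ℒ y} ∪ S)
    (hS : S ⊆ 𝕏)
    (hsaddle : ∀ x ∈ S, ∃ H : Matrix (Fin n) (Fin n) ℝ, ∃ hH : H.IsHermitian,
      HasFDerivAt (gradient ℒ) (Matrix.toEuclideanCLM (𝕜 := ℝ) H) x ∧
      (∃ i, hH.eigenvalues i < 0) ∧ (∃ j, 0 ≤ hH.eigenvalues j))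
    (hprecompact : ∀ ξ ∈ 𝕏, ∃ φ : ℝ → EuclideanSpace ℝ (Fin n), φ 0 = ξ ∧
      (∀ t ∈ Ici (0 : ℝ), φ t ∈ 𝕏 ∧
        HasDerivWithinAt φ (-(gradient ℒ (φ t))) (Ici 0) t) ∧
      ∃ Kc : Set (EuclideanSpace ℝ (Fin n)), IsCompact Kc ∧ Kc ⊆ 𝕏 ∧
        ∀ t ∈ Ici (0 : ℝ), φ t ∈ Kc) :
    volume {ξ : EuclideanSpace ℝ (Fin n) | ξ ∈ 𝕏 ∧
      ¬ ∃ φ : ℝ → EuclideanSpace ℝ (Fin n), φ 0 = ξ ∧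
        (∀ t ∈ Ici (0 : ℝ), φ t ∈ 𝕏 ∧
          HasDerivWithinAt φ (-(gradient ℒ (φ t))) (Ici 0) t) ∧
        ∃ x ∈ 𝕏, (∀ y ∈ 𝕏, ℒ x ≤ ℒ y) ∧ Tendsto φ atTop (nhds x)} = 0 := by
  have hregion : ∀ x ∈ S, ∃ U ∈ nhds x, GradientFlow.IsUnstableRegion (Fin n) ℒ U := by
    intro x hx
    obtain ⟨H, hH, hderiv, hneg, -⟩ := hsaddle x hx
    obtain ⟨l, U, hU, hreg⟩ := GradientFlow.exists_isSaddleRegion (han x (hS hx)) hderiv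
      (GradientFlow.inner_eigenvectorBasis_toEuclideanCLM hH) hneg
    exact ⟨U, hU, _, _, _, l, hreg, hneg⟩
  refine measure_mono_null ?_ (GradientFlow.measure_zero_of_tendsto volume (Fin n) hX han hregion)
  rintro ξ ⟨hξ, hbad⟩
  obtain ⟨φ, h0, hφ, K, hK, hKX, hφK⟩ := hprecompact ξ hξ
  obtain ⟨a, haK, hgrad, hlim⟩ :=
    GradientFlow.IsTrajectory.exists_tendsto hφ han hK hKX hφK
  have ha : a ∈ {x | x ∈ 𝕏 ∧ gradient ℒ x = 0} := ⟨hKX haK, hgrad⟩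
  rw [hZ] at ha
  rcases ha with ha | ha
  · exact absurd ⟨φ, h0, hφ, a, ha.1, ha.2, hlim⟩ hbad
  · exact ⟨φ, h0, hφ, ⟨K, hK, hKX, hφK⟩, a, ha, hlim⟩
end

section
/- Let p, q, o be positive integers with q ≥ o, and let A ∈ ℝ^{p×o}, B ∈ ℝ^{q×o}. Then the following are equivalent: (1) A·Bᵀ = 0; (2) there exist orthogonal matrices Ψ_A ∈ O(p), Ψ_B ∈ O(q), Φ ∈ O(o) and rectangular diagonal matrices Σ_A ∈ ℝ^{p×o}, Σ_B ∈ ℝ^{q×o} with nonnegative diagonal entries such that A = Ψ_A·Σ_A·Φᵀ and B = Ψ_B·Σ_B·Φᵀ are singular value decompositions of A and B, and Σ_A·Σ_Bᵀ = 0. -/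
open Matrix

/-- A rectangular diagonal matrix: all entries off the main diagonal vanish. -/
def Matrix.IsRectDiagonal {p o : ℕ} (M : Matrix (Fin p) (Fin o) ℝ) : Prop :=
  ∀ (i : Fin p) (j : Fin o), (i : ℕ) ≠ (j : ℕ) → M i j = 0

/-- A symmetric real matrix has an orthogonal diagonalization with decreasing eigenvalues. -/
lemma Matrix.IsSymm.exists_orthogonal_antitone_diagonal {o : ℕ} {C : Matrix (Fin o) (Fin o) ℝ}
    (hC : C.IsSymm) :
    ∃ (Φ : Matrix (Fin o) (Fin o) ℝ) (l : Fin o → ℝ),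
      Φᵀ * Φ = 1 ∧ Antitone l ∧ Φᵀ * C * Φ = diagonal l := by
  have hT : (Matrix.toEuclideanLin C).IsSymmetric :=
    Matrix.isSymmetric_toEuclideanLin_iff.mpr (by rw [IsHermitian, conjTranspose_eq_transpose_of_trivial]; exact hC)
  have hn : Module.finrank ℝ (EuclideanSpace ℝ (Fin o)) = o := by simp
  set b := hT.eigenvectorBasis hn
  set l := hT.eigenvalues hn
  let Φ : Matrix (Fin o) (Fin o) ℝ := of fun k i => b i k
  have hΦ : Φᵀ * Φ = 1 := by
    ext i j
    have := orthonormal_iff_ite.mp b.orthonormal j i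
    simp only [PiLp.inner_apply, RCLike.inner_apply, conj_trivial] at this
    simpa [Φ, Matrix.mul_apply, Matrix.one_apply, eq_comm] using this
  have hCΦ : C * Φ = Φ * diagonal l := by
    ext k i
    rw [mul_diagonal, mul_comm]
    exact congrArg (fun v : EuclideanSpace ℝ (Fin o) => v k) (hT.apply_eigenvectorBasis hn i)
  refine ⟨Φ, l, hΦ, hT.eigenvalues_antitone hn, ?_⟩
  rw [Matrix.mul_assoc, hCΦ, ← Matrix.mul_assoc, hΦ, Matrix.one_mul]

/-- A matrix with orthogonal columns, those of index at least the number of rows being zero, is an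
orthogonal matrix times a nonnegative rectangular diagonal matrix. -/
lemma Matrix.exists_orthogonal_mul_rectDiagonal {m o : ℕ} {N : Matrix (Fin m) (Fin o) ℝ}
    {d : Fin o → ℝ} (hN : Nᵀ * N = diagonal d) (hd : ∀ j, d j ≠ 0 → (j : ℕ) < m) :
    ∃ (Ψ : Matrix (Fin m) (Fin m) ℝ) (S : Matrix (Fin m) (Fin o) ℝ),
      Ψᵀ * Ψ = 1 ∧ S.IsRectDiagonal ∧ (∀ i j, 0 ≤ S i j) ∧ N = Ψ * S := by
  have hsum (i j : Fin o) : ∑ k, N k i * N k j = if i = j then d i else 0 := by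
    simpa [Matrix.mul_apply, diagonal_apply] using congrFun₂ hN i j
  have hd0 (j : Fin o) : 0 ≤ d j := by
    have := hsum j j
    rw [if_pos rfl] at this
    exact this ▸ Finset.sum_nonneg fun k _ => mul_self_nonneg _
  have hcol (j : Fin o) (hj : d j = 0) (k : Fin m) : N k j = 0 := by
    have h := hsum j j
    rw [if_pos rfl, hj, Finset.sum_eq_zero_iff_of_nonneg fun k _ => mul_self_nonneg _] at h
    exact mul_self_eq_zero.mp (h k (Finset.mem_univ k))
  let v : Fin m → EuclideanSpace ℝ (Fin m) := fun i =>
    if h : (i : ℕ) < o then WithLp.toLp 2 fun k => (√(d ⟨i, h⟩))⁻¹ * N k ⟨i, h⟩ else 0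
  let s : Set (Fin m) := {i | ∃ h : (i : ℕ) < o, d ⟨i, h⟩ ≠ 0}
  have hv : Orthonormal ℝ (s.domRestrict v) := by
    rw [orthonormal_iff_ite]
    rintro ⟨i, hi, hdi⟩ ⟨j, hj, hdj⟩
    have hsq : (√(d ⟨i, hi⟩))⁻¹ * (√(d ⟨i, hi⟩))⁻¹ * d ⟨i, hi⟩ = 1 := by
      rw [← mul_inv, Real.mul_self_sqrt (hd0 _), inv_mul_cancel₀ hdi]
    have hinner : inner ℝ (v i) (v j) =
        (√(d ⟨i, hi⟩))⁻¹ * (√(d ⟨j, hj⟩))⁻¹ * ∑ k, N k ⟨i, hi⟩ * N k ⟨j, hj⟩ := by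
      simp only [v, hi, hj, dite_true, PiLp.inner_apply, RCLike.inner_apply, conj_trivial,
        Finset.mul_sum]
      exact Finset.sum_congr rfl fun k _ => by ring
    simp only [Subtype.mk.injEq]
    change inner ℝ (v i) (v j) = _
    rw [hinner, hsum]
    by_cases hij : i = j
    · subst hij
      simpa using hsq
    · simp [hij, Fin.val_inj]
  obtain ⟨b, hb⟩ := hv.exists_orthonormalBasis_extension_of_card_eq (by simp)
  refine ⟨of fun k i => b i k, of fun i j => if (i : ℕ) = j then √(d j) else 0, ?_, ?_, ?_, ?_⟩
  · ext i j
    have := orthonormal_iff_ite.mp b.orthonormal j i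
    simp only [PiLp.inner_apply, RCLike.inner_apply, conj_trivial] at this
    simpa [Matrix.mul_apply, Matrix.one_apply, eq_comm] using this
  · intro i j hij
    simp [hij]
  · intro i j
    simp only [of_apply]
    split_ifs <;> positivity
  · ext k j
    simp only [Matrix.mul_apply, of_apply]
    by_cases hj : d j = 0
    · simp [hcol j hj, hj]
    · have hjm := hd j hj
      rw [Finset.sum_eq_single_of_mem (⟨j, hjm⟩ : Fin m) (Finset.mem_univ _)
        fun i _ hi => by rw [if_neg fun h => hi (Fin.ext h), mul_zero]]
      have hs : √(d j) ≠ 0 := (Real.sqrt_pos.mpr (lt_of_le_of_ne (hd0 j) (Ne.symm hj))).ne'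
      rw [hb ⟨j, hjm⟩ ⟨j.isLt, hj⟩]
      simp only [v, j.isLt, dite_true, if_true, Fin.eta]
      field_simp

/-- If symmetric matrices `G`, `H` with nonnegative diagonal satisfy `G * H = 0` and `G - H` is
diagonal, then `G` is the positive part of `G - H`. -/
lemma Matrix.IsSymm.eq_diagonal_posPart {n : Type*} [Fintype n] [DecidableEq n]
    {G H : Matrix n n ℝ} {l : n → ℝ} (hG : G.IsSymm) (hH : H.IsSymm) (hG0 : ∀ j, 0 ≤ G j j)
    (hH0 : ∀ j, 0 ≤ H j j) (hGH : G * H = 0) (hl : G - H = diagonal l) :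
    G = diagonal fun j => max (l j) 0 := by
  have hHG : H * G = 0 := by
    rw [← hG.eq, ← hH.eq, ← Matrix.transpose_mul, hGH, transpose_zero]
  have hGG : G * G = G * diagonal l := by rw [← hl, Matrix.mul_sub, hGH, sub_zero]
  have hHH : H * H = -(H * diagonal l) := by rw [← hl, Matrix.mul_sub, hHG, zero_sub, neg_neg]
  have hzero {K : Matrix n n ℝ} (hK : K.IsSymm) (j : n) (h : (K * K) j j ≤ 0) (i : n) :
      K i j = 0 := by
    have hs : ∑ k, K k j * K k j ≤ 0 := by
      simpa only [Matrix.mul_apply, hK.apply] using h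
    have h0 := (Finset.sum_eq_zero_iff_of_nonneg fun k _ => mul_self_nonneg (K k j)).mp
      (le_antisymm hs (Finset.sum_nonneg fun k _ => mul_self_nonneg (K k j)))
    exact mul_self_eq_zero.mp (h0 i (Finset.mem_univ i))
  ext i j
  rcases le_total (l j) 0 with h | h
  · have hGj := hzero hG j (by
      rw [hGG, mul_diagonal]
      exact mul_nonpos_of_nonneg_of_nonpos (hG0 j) h) i
    rw [hGj, diagonal_apply]
    split_ifs with hij
    · rw [hij, max_eq_right h]
    · rfl
  · have hHj := hzero hH j (by
      rw [hHH, Matrix.neg_apply, mul_diagonal]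
      exact neg_nonpos.mpr (mul_nonneg (hH0 j) h)) i
    have hij := congrFun₂ hl i j
    rw [Matrix.sub_apply, hHj, sub_zero] at hij
    rw [hij, diagonal_apply, diagonal_apply]
    split_ifs with hij
    · rw [hij, max_eq_left h]
    · rfl

/-- A positive entry of a decreasing diagonal has index below the rank of its positive part. -/
lemma Matrix.lt_rank_diagonal_posPart {o : ℕ} {l : Fin o → ℝ} (hl : Antitone l) {j : Fin o}
    (hj : 0 < l j) : (j : ℕ) < (diagonal fun j => max (l j) 0).rank := by
  classical
  rw [rank_diagonal, Fintype.card_subtype]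
  calc (j : ℕ) < (Finset.Iic j).card := by simp
    _ ≤ _ := Finset.card_le_card fun i hi => by
      have : 0 < l i := hj.trans_le (hl (Finset.mem_Iic.mp hi))
      simp [this]

/-- **Simultaneous SVDs of matrices with orthogonal row spaces.**
For `A ∈ ℝ^{p×o}`, `B ∈ ℝ^{q×o}` with `q ≥ o`, one has `A·Bᵀ = 0` iff there are SVDs
`A = Ψ_A Σ_A Φᵀ` and `B = Ψ_B Σ_B Φᵀ` sharing the same right-singular-vector matrix `Φ`,
with `Σ_A·Σ_Bᵀ = 0`. -/
theorem simultaneous_svd_of_orthogonal_rows {p q o : ℕ}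
    (hp : 0 < p) (hq : 0 < q) (ho : 0 < o) (hqo : o ≤ q)
    (A : Matrix (Fin p) (Fin o) ℝ) (B : Matrix (Fin q) (Fin o) ℝ) :
    A * Bᵀ = 0 ↔
      ∃ (PsiA : Matrix (Fin p) (Fin p) ℝ) (PsiB : Matrix (Fin q) (Fin q) ℝ)
        (Φ : Matrix (Fin o) (Fin o) ℝ)
        (SA : Matrix (Fin p) (Fin o) ℝ) (SB : Matrix (Fin q) (Fin o) ℝ),
        PsiAᵀ * PsiA = 1 ∧ PsiBᵀ * PsiB = 1 ∧ Φᵀ * Φ = 1 ∧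
        SA.IsRectDiagonal ∧ (∀ i j, 0 ≤ SA i j) ∧
        SB.IsRectDiagonal ∧ (∀ i j, 0 ≤ SB i j) ∧
        A = PsiA * SA * Φᵀ ∧ B = PsiB * SB * Φᵀ ∧ SA * SBᵀ = 0 := by
  constructor
  · intro hAB
    have hsymm {m : ℕ} (M : Matrix (Fin m) (Fin o) ℝ) : (Mᵀ * M).IsSymm := by
      rw [IsSymm, Matrix.transpose_mul, transpose_transpose]
    have hC : (Aᵀ * A - Bᵀ * B).IsSymm := (hsymm A).sub (hsymm B)
    obtain ⟨Φ, l, hΦ, hl, hD⟩ := hC.exists_orthogonal_antitone_diagonal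
    have hΦ' : Φ * Φᵀ = 1 := mul_eq_one_comm.mp hΦ
    have hMN : A * Φ * (B * Φ)ᵀ = 0 := by
      rw [Matrix.transpose_mul, Matrix.mul_assoc, ← Matrix.mul_assoc Φ, hΦ', Matrix.one_mul, hAB]
    have hNM : B * Φ * (A * Φ)ᵀ = 0 := by
      simpa only [Matrix.transpose_mul, transpose_transpose, transpose_zero] using
        congrArg transpose hMN
    have hsub : (A * Φ)ᵀ * (A * Φ) - (B * Φ)ᵀ * (B * Φ) = diagonal l := by
      rw [← hD, Matrix.mul_sub, Matrix.sub_mul]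
      simp only [Matrix.transpose_mul, Matrix.mul_assoc]
    have hmul {m n : ℕ} {M : Matrix (Fin m) (Fin o) ℝ} {N : Matrix (Fin n) (Fin o) ℝ}
        (h : M * Nᵀ = 0) : Mᵀ * M * (Nᵀ * N) = 0 := by
      rw [Matrix.mul_assoc, ← Matrix.mul_assoc M, h, Matrix.zero_mul, Matrix.mul_zero]
    have hdiag {m : ℕ} (M : Matrix (Fin m) (Fin o) ℝ) (j : Fin o) : 0 ≤ (Mᵀ * M) j j := by
      rw [Matrix.mul_apply]
      exact Finset.sum_nonneg fun k _ => mul_self_nonneg (M k j)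
    have hG := (hsymm (A * Φ)).eq_diagonal_posPart
      (hsymm (B * Φ)) (hdiag _) (hdiag _) (hmul hMN) hsub
    have hH := (hsymm (B * Φ)).eq_diagonal_posPart (l := -l)
      (hsymm (A * Φ)) (hdiag _) (hdiag _) (hmul hNM)
      (by rw [← neg_sub, hsub, diagonal_neg]; rfl)
    obtain ⟨PsiA, SA, hPA, hSA, hSA0, hA⟩ := exists_orthogonal_mul_rectDiagonal hG (by
      intro j hj
      have hlj : 0 < l j := by
        by_contra! h
        exact hj (max_eq_right h)
      refine (lt_rank_diagonal_posPart hl hlj).trans_le ?_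
      rw [← hG]
      exact (rank_mul_le_right _ _).trans (rank_le_height _))
    obtain ⟨PsiB, SB, hPB, hSB, hSB0, hB⟩ := exists_orthogonal_mul_rectDiagonal hH
      fun j _ => j.isLt.trans_le hqo
    refine ⟨PsiA, PsiB, Φ, SA, SB, hPA, hPB, hΦ, hSA, hSA0, hSB, hSB0, ?_, ?_, ?_⟩
    · rw [← hA, Matrix.mul_assoc, hΦ', Matrix.mul_one]
    · rw [← hB, Matrix.mul_assoc, hΦ', Matrix.mul_one]
    · calc SA * SBᵀ = PsiAᵀ * PsiA * (SA * SBᵀ) * (PsiBᵀ * PsiB) := by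
            rw [hPA, hPB, Matrix.one_mul, Matrix.mul_one]
        _ = PsiAᵀ * (PsiA * SA * (PsiB * SB)ᵀ) * PsiB := by
            simp only [Matrix.transpose_mul, Matrix.mul_assoc]
        _ = 0 := by rw [← hA, ← hB, hMN, Matrix.mul_zero, Matrix.zero_mul]
  · rintro ⟨PsiA, PsiB, Φ, SA, SB, -, -, hΦ, -, -, -, -, rfl, rfl, hS⟩
    calc PsiA * SA * Φᵀ * (PsiB * SB * Φᵀ)ᵀ = PsiA * (SA * (Φᵀ * Φ) * SBᵀ) * PsiBᵀ := by
          simp only [Matrix.transpose_mul, transpose_transpose, Matrix.mul_assoc]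
      _ = 0 := by rw [hΦ, Matrix.mul_one, hS, Matrix.mul_zero, Matrix.zero_mul]
end

section
/- Fix real numbers a, q, r with q > 0, r > 0, and an integer κ ≥ 1. Define f(k₁,k₂) := -(r⟨k₂,k₁⟩² + 2ar⟨k₂,k₁⟩ - q)/(2(a + ⟨k₂,k₁⟩)²) on 𝒦 := {(k₁,k₂) ∈ ℝ^κ × ℝ^κ : a + ⟨k₂,k₁⟩ < 0}. Let k₁, k₂ : [0,T) → ℝ^κ be differentiable with (k₁(t),k₂(t)) ∈ 𝒦 for all t and satisfying the gradient-flow dynamics k₁'(t) = -f(k₁(t),k₂(t))·k₂(t) and k₂'(t) = -f(k₁(t),k₂(t))·k₁(t). Then: (i) (k₁ - k₂)'(t) = f(k₁(t),k₂(t))·(k₁(t) - k₂(t)) and (k₁ + k₂)'(t) = -f(k₁(t),k₂(t))·(k₁(t) + k₂(t)) for all t; (ii) ‖k₁(t) - k₂(t)‖ = ‖k₁(0) - k₂(0)‖·exp(∫₀^t f(k₁(s),k₂(s)) ds) for all t ∈ [0,T); (iii) in particular, k₁(0) = k₂(0) if and only if k₁(t) = k₂(t) for all t ∈ [0,T). 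-/
open Set
open scoped RealInnerProductSpace

open scoped Topology in
/-- A solution on `[0, T)` of the scalar-coefficient linear equation `u' = g • u` with continuous `g`
is its initial value times the exponential of the integral of `g`. -/
theorem eq_exp_integral_smul_of_hasDerivWithinAt {E : Type*} [NormedAddCommGroup E]
    [NormedSpace ℝ E] {g : ℝ → ℝ} {u : ℝ → E} {T : ℝ} (hg : ContinuousOn g (Ico 0 T))
    (hu : ∀ t ∈ Ico (0 : ℝ) T, HasDerivWithinAt u (g t • u t) (Ico 0 T) t)
    {t : ℝ} (ht : t ∈ Ico (0 : ℝ) T) :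
    u t = Real.exp (∫ s in (0 : ℝ)..t, g s) • u 0 := by
  have hsub : Icc 0 t ⊆ Ico 0 T := fun s hs => ⟨hs.1, hs.2.trans_lt ht.2⟩
  have hgint : ∀ x ∈ Icc 0 t, IntervalIntegrable g MeasureTheory.volume 0 x := fun x hx =>
    (hg.mono fun s hs => by
      rw [uIcc_of_le hx.1] at hs
      exact hsub ⟨hs.1, hs.2.trans hx.2⟩).intervalIntegrable
  have hcont : ContinuousOn (fun x => Real.exp (-∫ s in (0 : ℝ)..x, g s) • u x) (Icc 0 t) := by
    refine ContinuousOn.smul (Real.continuous_exp.comp_continuousOn ?_)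
      fun x hx => (hu x (hsub hx)).continuousWithinAt.mono hsub
    have h := intervalIntegral.continuousOn_primitive_interval'
      (hgint t ⟨ht.1, le_rfl⟩) left_mem_uIcc
    rw [uIcc_of_le ht.1] at h
    exact h.neg
  have hderiv : ∀ x ∈ Ico 0 t,
      HasDerivWithinAt (fun x => Real.exp (-∫ s in (0 : ℝ)..x, g s) • u x) 0 (Ici x) x := by
    intro x hx
    have hxT : x ∈ Ico 0 T := hsub ⟨hx.1, hx.2.le⟩
    have hnhds : Ico 0 T ∈ 𝓝[≥] x :=
      Filter.mem_of_superset (Ico_mem_nhdsGE hxT.2) (Ico_subset_Ico_left hx.1)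
    have hnhds' : 𝓝[>] x ≤ 𝓝[Ico 0 T] x :=
      (nhdsWithin_mono x Ioi_subset_Ici_self).trans (nhdsWithin_le_of_mem hnhds)
    have hmeas : StronglyMeasurableAtFilter g (𝓝[>] x) :=
      (hg.stronglyMeasurableAtFilter_nhdsWithin measurableSet_Ico x).filter_mono hnhds'
    have hI : HasDerivWithinAt (fun x => ∫ s in (0 : ℝ)..x, g s) (g x) (Ici x) x :=
      intervalIntegral.integral_hasDerivWithinAt_right (hgint x ⟨hx.1, hx.2.le⟩) hmeas
        ((hg x hxT).mono_left hnhds')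
    refine (hI.neg.exp.smul ((hu x hxT).mono_of_mem_nhdsWithin hnhds)).congr_deriv ?_
    simp only [smul_smul, ← add_smul]
    simp
  have hconst := constant_of_has_deriv_right_zero hcont hderiv t ⟨ht.1, le_rfl⟩
  simp only [intervalIntegral.integral_same, neg_zero, Real.exp_zero, one_smul] at hconst
  rw [← hconst, smul_smul, ← Real.exp_add, add_neg_cancel, Real.exp_zero, one_smul]

/-- **Difference/sum dynamics and the balance of the vector-case gradient flow.**
Along any solution of `k₁' = -f·k₂`, `k₂' = -f·k₁` on `[0,T)` staying in the stabilizing set,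
(i) `(k₁-k₂)' = f·(k₁-k₂)` and `(k₁+k₂)' = -f·(k₁+k₂)`;
(ii) `‖k₁(t)-k₂(t)‖ = ‖k₁(0)-k₂(0)‖·exp(∫₀ᵗ f)`;
(iii) `k₁(0)=k₂(0)` iff `k₁(t)=k₂(t)` for all `t ∈ [0,T)`. -/
theorem vector_case_difference_dynamics (a q r : ℝ) (hq : 0 < q) (hr : 0 < r)
    (κ : ℕ) (hκ : 1 ≤ κ)
    (f : EuclideanSpace ℝ (Fin κ) → EuclideanSpace ℝ (Fin κ) → ℝ)
    (hf : ∀ k₁ k₂, f k₁ k₂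
      = -(r * ⟪k₂, k₁⟫ ^ 2 + 2 * a * r * ⟪k₂, k₁⟫ - q) / (2 * (a + ⟪k₂, k₁⟫) ^ 2))
    (T : ℝ) (hT : 0 < T)
    (k₁ k₂ : ℝ → EuclideanSpace ℝ (Fin κ))
    (hstab : ∀ t ∈ Ico (0 : ℝ) T, a + ⟪k₂ t, k₁ t⟫ < 0)
    (hflow₁ : ∀ t ∈ Ico (0 : ℝ) T,
      HasDerivWithinAt k₁ (-(f (k₁ t) (k₂ t)) • k₂ t) (Ico 0 T) t)
    (hflow₂ : ∀ t ∈ Ico (0 : ℝ) T,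
      HasDerivWithinAt k₂ (-(f (k₁ t) (k₂ t)) • k₁ t) (Ico 0 T) t) :
    (∀ t ∈ Ico (0 : ℝ) T,
      HasDerivWithinAt (fun s => k₁ s - k₂ s)
        (f (k₁ t) (k₂ t) • (k₁ t - k₂ t)) (Ico 0 T) t ∧
      HasDerivWithinAt (fun s => k₁ s + k₂ s)
        (-(f (k₁ t) (k₂ t)) • (k₁ t + k₂ t)) (Ico 0 T) t) ∧
    (∀ t ∈ Ico (0 : ℝ) T,
      ‖k₁ t - k₂ t‖
        = ‖k₁ 0 - k₂ 0‖ * Real.exp (∫ s in (0 : ℝ)..t, f (k₁ s) (k₂ s))) ∧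
    (k₁ 0 = k₂ 0 ↔ ∀ t ∈ Ico (0 : ℝ) T, k₁ t = k₂ t) := by
  have hsub : ∀ t ∈ Ico (0 : ℝ) T, HasDerivWithinAt (fun s => k₁ s - k₂ s)
      (f (k₁ t) (k₂ t) • (k₁ t - k₂ t)) (Ico 0 T) t := fun t ht =>
    ((hflow₁ t ht).sub (hflow₂ t ht)).congr_deriv (by module)
  have hadd : ∀ t ∈ Ico (0 : ℝ) T, HasDerivWithinAt (fun s => k₁ s + k₂ s)
      (-(f (k₁ t) (k₂ t)) • (k₁ t + k₂ t)) (Ico 0 T) t := fun t ht =>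
    ((hflow₁ t ht).add (hflow₂ t ht)).congr_deriv (by module)
  have hc₁ : ContinuousOn k₁ (Ico 0 T) := fun t ht => (hflow₁ t ht).continuousWithinAt
  have hc₂ : ContinuousOn k₂ (Ico 0 T) := fun t ht => (hflow₂ t ht).continuousWithinAt
  have hinner : ContinuousOn (fun t => ⟪k₂ t, k₁ t⟫) (Ico 0 T) := hc₂.inner hc₁
  have hcf : ContinuousOn (fun t => f (k₁ t) (k₂ t)) (Ico 0 T) := by
    simp only [hf]
    refine ContinuousOn.div (by fun_prop) (by fun_prop) fun t ht => ?_
    exact mul_ne_zero two_ne_zero (pow_ne_zero 2 (hstab t ht).ne)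
  have hsol : ∀ t ∈ Ico (0 : ℝ) T, k₁ t - k₂ t
      = Real.exp (∫ s in (0 : ℝ)..t, f (k₁ s) (k₂ s)) • (k₁ 0 - k₂ 0) := fun t ht =>
    eq_exp_integral_smul_of_hasDerivWithinAt hcf hsub ht
  refine ⟨fun t ht => ⟨hsub t ht, hadd t ht⟩, fun t ht => ?_, fun h t ht => ?_,
    fun h => h 0 ⟨le_rfl, hT⟩⟩
  · rw [hsol t ht, norm_smul, Real.norm_of_nonneg (Real.exp_pos _).le, mul_comm]
  · rw [← sub_eq_zero, hsol t ht, h, sub_self, smul_zero]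
end
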